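/- arXiv:math/0208129 — 3 statements merged into one kernel-verified Lean document; each statement's English description precedes it below -/
import Mathlib

section
/- Let n ∈ ℕ, k ∈ {1, …, n-1}, δ ∈ (0,1), and let f : ℝⁿ → ℂ be continuous with f(x) = O(|x|^{-k-δ}) as |x| → ∞. Then for every x ∈ ℝⁿ: I^k f is well defined by an absolutely convergent integral, there exists a holomorphic function F on the strip {α ∈ ℂ : -k < Re α < δ} with F(α) = I^α(I^k f)(x) = (1/H_n(α)) ∫_{ℝⁿ} (I^k f)(y)|x - y|^{α-n} dy whenever 0 < Re α < δ, and the limit along real s of F(s) as s → -k⁺ exists and equals f(x). (This is the analytic core of the inversion formula f = (4π)^{-k/2} (Γ((n-k)/2)/Γ(n/2)) lim_{s → -k⁺} I^s (f̂)ˇ, since the dual of the k-plane transform satisfies (f̂)ˇ = (4π)^{k/2} (Γ(n/2)/Γ((n-k)/2)) I^k f.) -/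
open Complex MeasureTheory Filter Asymptotics Set Metric

/-- `H_n(α) = 2^α π^(n/2) Γ(α/2) / Γ((n-α)/2)`. -/
noncomputable def Hfun (n : ℕ) (α : ℂ) : ℂ :=
  (2 : ℂ) ^ α * (Real.pi : ℂ) ^ ((n : ℂ) / 2) * Complex.Gamma (α / 2) /
    Complex.Gamma (((n : ℂ) - α) / 2)

/-- The Riesz potential `(I^α f)(x) = (1/H_n(α)) ∫_{ℝⁿ} f(y) |x-y|^{α-n} dy`. -/
noncomputable def riesz (n : ℕ) (f : EuclideanSpace ℝ (Fin n) → ℂ) (α : ℂ)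
    (x : EuclideanSpace ℝ (Fin n)) : ℂ :=
  (Hfun n α)⁻¹ * ∫ y : EuclideanSpace ℝ (Fin n), f y * (‖x - y‖ : ℂ) ^ (α - n)


lemma integral_inv_gamma {s : ℂ} (hs : 0 < s.re) {r : ℝ} (hr : 0 < r) :
    IntegrableOn (fun u : ℝ => (u : ℂ) ^ (-s - 1) * Complex.exp (-(r / u))) (Ioi 0) ∧
      ∫ u : ℝ in Ioi 0, (u : ℂ) ^ (-s - 1) * Complex.exp (-(r / u)) =
        (1 / (r : ℂ)) ^ s * Complex.Gamma s := by
  have hfun : (fun u : ℝ => Complex.exp (-(r / u))) =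
      fun u : ℝ => (fun t : ℝ => Complex.exp (-(r * t))) (u ^ (-1 : ℝ)) := by
    ext u
    simp [Real.rpow_neg_one, div_eq_mul_inv]
  have hconv : MellinConvergent (fun t : ℝ => Complex.exp (-(r * t))) s := by
    refine mellinConvergent_of_isBigO_rpow_exp (a := r) (b := 0) hr ?_ ?_ ?_ hs
    · exact (by fun_prop : Continuous fun t : ℝ =>
        Complex.exp (-(r * t))).locallyIntegrable.locallyIntegrableOn _
    · refine IsBigO.of_norm_eventuallyLE (Eventually.of_forall fun t => ?_)
      simp [Complex.norm_exp]
    · simp only [neg_zero, Real.rpow_zero]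
      refine IsBigO.of_bound 1 (eventually_nhdsWithin_of_forall fun t ht => ?_)
      have : 0 ≤ r * t := mul_nonneg hr.le (le_of_lt ht)
      simp [Complex.norm_exp, this]
  refine ⟨?_, ?_⟩
  · have h := (MellinConvergent.comp_rpow (f := fun t : ℝ => Complex.exp (-(r * t))) (s := -s)
      (a := -1) (by norm_num)).2 (by simpa using hconv)
    rw [← hfun] at h
    simpa [MellinConvergent] using h
  · have h := mellin_comp_inv (fun t : ℝ => Complex.exp (-(r * t))) (-s)
    simp only [mellin, smul_eq_mul, neg_neg] at h
    rw [Complex.integral_cpow_mul_exp_neg_mul_Ioi hs hr] at h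
    rw [← h]
    simp [div_eq_mul_inv]

lemma intervalIntegrable_beta_scaled {s t : ℂ} (hs : 0 < s.re) (ht : 0 < t.re) {w : ℝ}
    (hw : 0 < w) :
    IntegrableOn (fun u : ℝ => (u : ℂ) ^ (s - 1) * ((w : ℂ) - u) ^ (t - 1)) (Ioo 0 w) := by
  have h := (Complex.betaIntegral_convergent hs ht).comp_mul_left (c := w⁻¹)
  simp only [zero_div, one_div, inv_inv] at h
  have h2 := (h.const_mul ((w : ℂ) ^ (s - 1) * (w : ℂ) ^ (t - 1)))
  rw [intervalIntegrable_iff_integrableOn_Ioo_of_le hw.le] at h2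
  refine h2.congr_fun (fun u hu => ?_) measurableSet_Ioo
  have e1 : ((u : ℝ) : ℂ) = (w : ℂ) * ((w⁻¹ * u : ℝ) : ℂ) := by
    push_cast
    rw [mul_inv_cancel_left₀ (by exact_mod_cast hw.ne')]
  have e2 : (w : ℂ) - u = (w : ℂ) * ((1 - w⁻¹ * u : ℝ) : ℂ) := by
    push_cast
    rw [mul_sub, mul_inv_cancel_left₀ (by exact_mod_cast hw.ne'), mul_one]
  have h01 : 0 ≤ 1 - w⁻¹ * u := by
    have : w⁻¹ * u ≤ w⁻¹ * w := by gcongr; exact hu.2.le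
    rw [inv_mul_cancel₀ hw.ne'] at this
    linarith
  have h02 : 0 ≤ w⁻¹ * u := mul_nonneg (inv_nonneg.2 hw.le) hu.1.le
  simp only
  rw [e2, Complex.mul_cpow_ofReal_nonneg hw.le h01]
  conv_rhs => rw [e1]
  rw [Complex.mul_cpow_ofReal_nonneg hw.le h02]
  push_cast
  ring

lemma norm_beta_integrand (s t : ℂ) {u w : ℝ} (hu : u ∈ Ioo 0 w) :
    ‖(u : ℂ) ^ (s - 1) * ((w : ℂ) - u) ^ (t - 1)‖ =
      ‖(u : ℂ) ^ ((s.re : ℂ) - 1) * ((w : ℂ) - u) ^ ((t.re : ℂ) - 1)‖ := by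
  have : (w : ℂ) - u = ((w - u : ℝ) : ℂ) := by push_cast; rfl
  rw [this, norm_mul, norm_mul]
  simp only [Complex.norm_cpow_eq_rpow_re_of_pos hu.1,
    Complex.norm_cpow_eq_rpow_re_of_pos (sub_pos.2 hu.2)]
  simp

lemma setIntegral_beta_scaled (s t : ℂ) {w : ℝ} (hw : 0 < w) :
    ∫ u : ℝ in Ioo 0 w, (u : ℂ) ^ (s - 1) * ((w : ℂ) - u) ^ (t - 1) =
      (w : ℂ) ^ (s + t - 1) * s.betaIntegral t := by
  rw [← Complex.betaIntegral_scaled s t hw, intervalIntegral.integral_of_le hw.le,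
    integral_Ioc_eq_integral_Ioo]

lemma setIntegral_norm_beta_scaled (s t : ℂ) {w : ℝ} (hw : 0 < w) :
    ∫ u : ℝ in Ioo 0 w, ‖(u : ℂ) ^ (s - 1) * ((w : ℂ) - u) ^ (t - 1)‖ =
      ‖(w : ℂ) ^ (s + t - 1)‖ * ‖(s.re : ℂ).betaIntegral t.re‖ := by
  have h0 : 0 ≤ ∫ u : ℝ in Ioo 0 w, ‖(u : ℂ) ^ (s - 1) * ((w : ℂ) - u) ^ (t - 1)‖ :=
    integral_nonneg fun _ => norm_nonneg _
  have h := setIntegral_beta_scaled (s.re : ℂ) (t.re : ℂ) hw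
  have h1 : ((∫ u : ℝ in Ioo 0 w, ‖(u : ℂ) ^ (s - 1) * ((w : ℂ) - u) ^ (t - 1)‖ : ℝ) : ℂ) =
      (w : ℂ) ^ ((s.re : ℂ) + t.re - 1) * (s.re : ℂ).betaIntegral t.re := by
    rw [← h, ← integral_complex_ofReal]
    refine setIntegral_congr_fun measurableSet_Ioo fun u hu => ?_
    have : (w : ℂ) - u = ((w - u : ℝ) : ℂ) := by push_cast; rfl
    simp only [norm_beta_integrand s t hu]
    rw [this, norm_mul, Complex.norm_cpow_eq_rpow_re_of_pos hu.1,
      Complex.norm_cpow_eq_rpow_re_of_pos (sub_pos.2 hu.2)]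
    push_cast [Complex.ofReal_cpow hu.1.le, Complex.ofReal_cpow (sub_pos.2 hu.2).le]
    simp
  have h2 := congrArg norm h1
  rw [Complex.norm_real, Real.norm_of_nonneg h0, norm_mul] at h2
  rw [h2, Complex.norm_cpow_eq_rpow_re_of_pos hw, Complex.norm_cpow_eq_rpow_re_of_pos hw]
  simp

/-- `∫∫ u^(s-1) v^(t-1) g(u+v) du dv = B(s,t) ∫ w^(s+t-1) g(w) dw` over the positive quadrant. -/
lemma integral_quadrant_beta {s t : ℂ} (hs : 0 < s.re) (ht : 0 < t.re) {g : ℝ → ℂ}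
    (hg : Measurable g) (hi : IntegrableOn (fun w : ℝ => (w : ℂ) ^ (s + t - 1) * g w) (Ioi 0)) :
    Integrable (fun p : ℝ × ℝ => (p.1 : ℂ) ^ (s - 1) * (p.2 : ℂ) ^ (t - 1) * g (p.1 + p.2))
        ((volume.restrict (Ioi 0)).prod (volume.restrict (Ioi 0))) ∧
      ∫ p : ℝ × ℝ, (p.1 : ℂ) ^ (s - 1) * (p.2 : ℂ) ^ (t - 1) * g (p.1 + p.2)
        ∂((volume.restrict (Ioi 0)).prod (volume.restrict (Ioi 0))) =
        s.betaIntegral t * ∫ w : ℝ in Ioi 0, (w : ℂ) ^ (s + t - 1) * g w := by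
  set K : ℝ × ℝ → ℂ := indicator {q | q.1 ∈ Ioo 0 q.2}
    fun q => (q.1 : ℂ) ^ (s - 1) * ((q.2 : ℂ) - q.1) ^ (t - 1) * g q.2 with hK
  have hset : MeasurableSet {q : ℝ × ℝ | q.1 ∈ Ioo 0 q.2} :=
    (measurableSet_lt measurable_const measurable_fst).inter
      (measurableSet_lt measurable_fst measurable_snd)
  have hKm : Measurable K := by
    refine Measurable.indicator ?_ hset
    fun_prop
  have hKw : ∀ w : ℝ, (fun u => K (u, w)) = indicator (Ioo 0 w)
      fun u : ℝ => (u : ℂ) ^ (s - 1) * ((w : ℂ) - u) ^ (t - 1) * g w := by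
    intro w
    ext u
    simp only [hK, indicator, mem_ofPred_eq]
  have hKneg : ∀ w : ℝ, w ≤ 0 → (fun u => K (u, w)) = 0 := by
    intro w hw
    rw [hKw, Ioo_eq_empty (by simpa using hw), indicator_empty]
    rfl
  have hKint : ∀ w : ℝ, 0 < w → Integrable (fun u => K (u, w)) := by
    intro w hw
    rw [hKw, integrable_indicator_iff measurableSet_Ioo]
    exact (intervalIntegrable_beta_scaled hs ht hw).mul_const _
  have hKnorm : (fun w => ∫ u, ‖K (u, w)‖) = indicator (Ioi 0)
      fun w : ℝ => ‖(w : ℂ) ^ (s + t - 1) * g w‖ * ‖(s.re : ℂ).betaIntegral t.re‖ := by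
    ext w
    by_cases hw : 0 < w
    · rw [indicator_of_mem (mem_Ioi.2 hw)]
      have : (fun u => ‖K (u, w)‖) = indicator (Ioo 0 w)
          fun u : ℝ => ‖(u : ℂ) ^ (s - 1) * ((w : ℂ) - u) ^ (t - 1)‖ * ‖g w‖ := by
        ext u
        rw [congrFun (hKw w) u, norm_indicator_eq_indicator_norm]
        simp only [norm_mul]
      rw [this, integral_indicator measurableSet_Ioo, integral_mul_const,
        setIntegral_norm_beta_scaled s t hw, norm_mul]
      ring
    · rw [indicator_of_notMem (by simpa using hw)]
      have := hKneg w (not_lt.1 hw)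
      have h0 : ∀ u, K (u, w) = 0 := fun u => congrFun this u
      simp [h0]
  have hKI : Integrable K (volume.prod volume) := by
    rw [integrable_prod_iff' hKm.aestronglyMeasurable]
    refine ⟨Eventually.of_forall fun w => ?_, ?_⟩
    · by_cases hw : 0 < w
      · exact hKint w hw
      · rw [hKneg w (not_lt.1 hw)]
        exact integrable_zero _ _ _
    · rw [hKnorm, integrable_indicator_iff measurableSet_Ioi]
      exact hi.norm.mul_const _
  have hKval : ∫ q, K q ∂(volume.prod volume) =
      s.betaIntegral t * ∫ w : ℝ in Ioi 0, (w : ℂ) ^ (s + t - 1) * g w := by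
    rw [integral_prod_symm _ hKI, ← integral_const_mul, ← integral_indicator measurableSet_Ioi]
    congr 1
    ext w
    by_cases hw : 0 < w
    · rw [indicator_of_mem (mem_Ioi.2 hw), hKw, integral_indicator measurableSet_Ioo,
        integral_mul_const, setIntegral_beta_scaled s t hw]
      ring
    · rw [indicator_of_notMem (by simpa using hw), hKneg w (not_lt.1 hw)]
      simp
  have hmp := measurePreserving_prod_add (volume : Measure ℝ) (volume : Measure ℝ)
  have hemb : MeasurableEmbedding fun z : ℝ × ℝ => (z.1, z.1 + z.2) :=
    (MeasurableEquiv.shearAddRight ℝ).measurableEmbedding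
  have hcomp : (K ∘ fun z : ℝ × ℝ => (z.1, z.1 + z.2)) = indicator (Ioi 0 ×ˢ Ioi 0)
      fun p : ℝ × ℝ => (p.1 : ℂ) ^ (s - 1) * (p.2 : ℂ) ^ (t - 1) * g (p.1 + p.2) := by
    ext p
    simp only [hK, Function.comp_apply, indicator, mem_ofPred_eq, mem_prod, mem_Ioi, mem_Ioo,
      lt_add_iff_pos_right]
    congr 1
    push_cast
    rw [add_sub_cancel_left]
  rw [Measure.prod_restrict]
  refine ⟨?_, ?_⟩
  · change IntegrableOn _ _ _
    rw [← integrable_indicator_iff (measurableSet_Ioi.prod measurableSet_Ioi), ← hcomp]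
    exact (hmp.integrable_comp_emb hemb).2 hKI
  · rw [← hKval, ← hmp.integral_comp hemb K,
      ← integral_indicator (measurableSet_Ioi.prod measurableSet_Ioi), ← hcomp]
    rfl

lemma gaussian_conv (n : ℕ) (x z : EuclideanSpace ℝ (Fin n)) {u v : ℝ} (hu : 0 < u) (hv : 0 < v) :
    Integrable (fun y : EuclideanSpace ℝ (Fin n) =>
        Complex.exp (-((‖x - y‖ ^ 2 : ℝ) / u)) * Complex.exp (-((‖y - z‖ ^ 2 : ℝ) / v))) ∧
      ∫ y : EuclideanSpace ℝ (Fin n),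
        Complex.exp (-((‖x - y‖ ^ 2 : ℝ) / u)) * Complex.exp (-((‖y - z‖ ^ 2 : ℝ) / v)) =
        (Real.pi : ℂ) ^ ((n : ℂ) / 2) * ((u : ℂ) ^ ((n : ℂ) / 2) * (v : ℂ) ^ ((n : ℂ) / 2) *
          ((u + v : ℝ) : ℂ) ^ (-((n : ℂ) / 2)) *
            Complex.exp (-((‖x - z‖ ^ 2 : ℝ) / ((u + v : ℝ) : ℂ)))) := by
  set b : ℂ := ((1 / u + 1 / v : ℝ) : ℂ) with hb
  have hb0 : 0 < 1 / u + 1 / v := by positivity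
  have hbre : 0 < b.re := by rw [hb, Complex.ofReal_re]; exact hb0
  set c : ℂ := -(2 / v : ℝ) with hc
  set F : EuclideanSpace ℝ (Fin n) → ℂ := fun y =>
    Complex.exp (-((‖x - y‖ ^ 2 : ℝ) / u)) * Complex.exp (-((‖y - z‖ ^ 2 : ℝ) / v)) with hF
  have hshift : (fun w => F (w + x)) = fun w => Complex.exp (-((‖x - z‖ ^ 2 : ℝ) / v)) *
      Complex.exp (-b * ‖w‖ ^ 2 + c * (inner ℝ (x - z) w : ℝ)) := by
    ext w
    simp only [hF]
    rw [← Complex.exp_add, ← Complex.exp_add]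
    congr 1
    have e1 : x - (w + x) = -w := by abel
    have e2 : w + x - z = w + (x - z) := by abel
    rw [e1, e2, norm_neg, norm_add_sq_real, real_inner_comm, hb, hc]
    push_cast
    ring
  have hi := GaussianFourier.integrable_cexp_neg_mul_sq_norm_add hbre c (x - z)
  have hval := GaussianFourier.integral_cexp_neg_mul_sq_norm_add hbre c (x - z)
  refine ⟨?_, ?_⟩
  · have h := (hi.const_mul (Complex.exp (-((‖x - z‖ ^ 2 : ℝ) / v))))
    rw [← hshift] at h
    simpa using h.comp_add_right (-x)
  · rw [← integral_add_right_eq_self F x, hshift, integral_const_mul, hval, finrank_euclideanSpace,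
      Fintype.card_fin]
    have hu' : (u : ℂ) ≠ 0 := by exact_mod_cast hu.ne'
    have hv' : (v : ℂ) ≠ 0 := by exact_mod_cast hv.ne'
    have huv : (u : ℂ) + v ≠ 0 := by exact_mod_cast (add_pos hu hv).ne'
    have hq : (Real.pi : ℂ) / b = ((Real.pi * (u * v * (u + v)⁻¹) : ℝ) : ℂ) := by
      rw [hb]
      push_cast
      field_simp
      rw [add_comm, div_self (by rwa [add_comm])]
    have hpow : ((Real.pi : ℂ) / b) ^ ((n : ℂ) / 2) = (Real.pi : ℂ) ^ ((n : ℂ) / 2) *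
        ((u : ℂ) ^ ((n : ℂ) / 2) * (v : ℂ) ^ ((n : ℂ) / 2) *
          ((u + v : ℝ) : ℂ) ^ (-((n : ℂ) / 2))) := by
      rw [hq, Complex.ofReal_mul, Complex.mul_cpow_ofReal_nonneg Real.pi_pos.le (by positivity),
        Complex.ofReal_mul, Complex.mul_cpow_ofReal_nonneg (by positivity) (by positivity),
        Complex.ofReal_mul, Complex.mul_cpow_ofReal_nonneg hu.le hv.le, Complex.ofReal_inv,
        Complex.inv_cpow, Complex.cpow_neg]
      rw [Complex.arg_ofReal_of_nonneg (by positivity)]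
      exact Real.pi_pos.ne
    have hsum : 1 / (u : ℂ) + 1 / v = (u + v) / (u * v) := by
      field_simp
      ring
    have hexp : Complex.exp (-((‖x - z‖ ^ 2 : ℝ) / v)) *
        Complex.exp (c ^ 2 * (‖x - z‖ : ℂ) ^ 2 / (4 * b)) =
        Complex.exp (-((‖x - z‖ ^ 2 : ℝ) / ((u + v : ℝ) : ℂ))) := by
      rw [← Complex.exp_add, hb, hc]
      congr 1
      push_cast
      rw [hsum]
      field_simp
      ring
    rw [hpow, ← hexp]
    ring

lemma integral_inv_gamma_norm {n : ℕ} {a : ℂ} (han : a.re < n) {r : ℝ} (hr : 0 < r) :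
    IntegrableOn (fun u : ℝ => (u : ℂ) ^ (a / 2 - n / 2 - 1) * Complex.exp (-((r ^ 2 : ℝ) / u)))
        (Ioi 0) ∧
      ∫ u : ℝ in Ioi 0, (u : ℂ) ^ (a / 2 - n / 2 - 1) * Complex.exp (-((r ^ 2 : ℝ) / u)) =
        Complex.Gamma ((n - a) / 2) * (r : ℂ) ^ (a - n) := by
  have hs : 0 < ((n - a) / 2 : ℂ).re := by
    simp
    linarith
  have h := integral_inv_gamma hs (r := r ^ 2) (by positivity)
  have e : -((n - a) / 2 : ℂ) - 1 = a / 2 - n / 2 - 1 := by ring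
  rw [e] at h
  refine ⟨h.1, ?_⟩
  rw [h.2, mul_comm]
  congr 1
  have hr' : (r : ℂ) ≠ 0 := by exact_mod_cast hr.ne'
  have hl : Complex.log ((r ^ 2 : ℝ) : ℂ) = 2 * Complex.log r := by
    rw [← Complex.ofReal_log (by positivity), ← Complex.ofReal_log hr.le, Real.log_pow]
    push_cast
    ring
  have harg : Complex.arg ((r ^ 2 : ℝ) : ℂ) ≠ Real.pi := by
    rw [Complex.arg_ofReal_of_nonneg (by positivity)]
    exact Real.pi_pos.ne
  rw [one_div, Complex.inv_cpow _ _ harg, ← Complex.cpow_neg,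
    Complex.cpow_def_of_ne_zero (by exact_mod_cast (pow_pos hr 2).ne'),
    Complex.cpow_def_of_ne_zero hr', hl]
  congr 1
  ring

lemma Hfun_ne_zero {n : ℕ} {a : ℂ} (ha : 0 < a.re) (han : a.re < n) : Hfun n a ≠ 0 := by
  have h1 : Complex.Gamma (a / 2) ≠ 0 := Complex.Gamma_ne_zero_of_re_pos (by simp; linarith)
  have h2 : Complex.Gamma ((n - a) / 2) ≠ 0 :=
    Complex.Gamma_ne_zero_of_re_pos (by simp; linarith)
  have h3 : (Real.pi : ℂ) ≠ 0 := by exact_mod_cast Real.pi_ne_zero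
  simp [Hfun, h1, h2, h3, Complex.cpow_eq_zero_iff]

lemma Hfun_mul {n : ℕ} {a b : ℂ} (ha : 0 < a.re) (hb : 0 < b.re) (hab : a.re + b.re < n) :
    Hfun n a * Hfun n b = Hfun n (a + b) * ((Real.pi : ℂ) ^ ((n : ℂ) / 2) *
      (a / 2).betaIntegral (b / 2) * Complex.Gamma ((n - (a + b)) / 2) /
        (Complex.Gamma ((n - a) / 2) * Complex.Gamma ((n - b) / 2))) := by
  have h := Complex.Gamma_mul_Gamma_eq_betaIntegral (s := a / 2) (t := b / 2)
    (by simp; linarith) (by simp; linarith)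
  rw [← add_div] at h
  have g1 : Complex.Gamma ((n - a) / 2) ≠ 0 :=
    Complex.Gamma_ne_zero_of_re_pos (by simp; linarith)
  have g2 : Complex.Gamma ((n - b) / 2) ≠ 0 :=
    Complex.Gamma_ne_zero_of_re_pos (by simp; linarith)
  have g3 : Complex.Gamma ((n - (a + b)) / 2) ≠ 0 :=
    Complex.Gamma_ne_zero_of_re_pos (by simp; linarith)
  simp only [Hfun]
  rw [Complex.cpow_add _ _ two_ne_zero]
  field_simp
  linear_combination h

/-- The composition formula for Riesz kernels, at distinct points. -/
lemma integral_kernel_mul_kernel {n : ℕ} {a b : ℂ} (ha : 0 < a.re) (hb : 0 < b.re)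
    (hab : a.re + b.re < n) {x z : EuclideanSpace ℝ (Fin n)} (hxz : x ≠ z) :
    Integrable (fun y => (‖x - y‖ : ℂ) ^ (a - n) * (‖y - z‖ : ℂ) ^ (b - n)) ∧
      ∫ y, (‖x - y‖ : ℂ) ^ (a - n) * (‖y - z‖ : ℂ) ^ (b - n) =
        Hfun n a * Hfun n b * (Hfun n (a + b))⁻¹ * (‖x - z‖ : ℂ) ^ (a + b - n) := by
  have hn : 0 < n := by
    have : (0 : ℝ) < n := by linarith
    exact_mod_cast this
  have : NeZero n := ⟨hn.ne'⟩
  have han : a.re < n := by linarith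
  have hbn : b.re < n := by linarith
  set ν : Measure (ℝ × ℝ) := (volume.restrict (Ioi 0)).prod (volume.restrict (Ioi 0)) with hν
  set P : ℝ × ℝ → ℂ := fun p => (p.1 : ℂ) ^ (a / 2 - n / 2 - 1) * (p.2 : ℂ) ^ (b / 2 - n / 2 - 1)
    with hP
  set G : EuclideanSpace ℝ (Fin n) → ℝ × ℝ → ℂ := fun y p =>
    Complex.exp (-((‖x - y‖ ^ 2 : ℝ) / p.1)) * Complex.exp (-((‖y - z‖ ^ 2 : ℝ) / p.2)) with hG
  set Φ : EuclideanSpace ℝ (Fin n) × (ℝ × ℝ) → ℂ := fun q => P q.2 * G q.1 q.2 with hΦ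
  have hΦm : Measurable Φ := by
    simp only [hΦ, hP, hG]
    fun_prop
  set g : ℝ → ℂ := fun w => (w : ℂ) ^ (-((n : ℂ) / 2)) *
    Complex.exp (-((‖x - z‖ ^ 2 : ℝ) / (w : ℂ))) with hg
  have hgm : Measurable g := by simp only [hg]; fun_prop
  have hd : 0 < ‖x - z‖ := norm_pos_iff.2 (sub_ne_zero.2 hxz)
  have hae : ∀ᵐ p ∂ν, 0 < p.1 ∧ 0 < p.2 := by
    rw [hν, Measure.prod_restrict]
    exact ae_restrict_mem (measurableSet_Ioi.prod measurableSet_Ioi)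
  -- the beta integral for a pair of exponents
  have hbeta : ∀ {s t : ℂ}, 0 < s.re → 0 < t.re → s.re + t.re < n →
      Integrable (fun p : ℝ × ℝ => (p.1 : ℂ) ^ (s / 2 - 1) * (p.2 : ℂ) ^ (t / 2 - 1) *
        g (p.1 + p.2)) ν ∧
      ∫ p : ℝ × ℝ, (p.1 : ℂ) ^ (s / 2 - 1) * (p.2 : ℂ) ^ (t / 2 - 1) * g (p.1 + p.2) ∂ν =
        (s / 2).betaIntegral (t / 2) *
          (Complex.Gamma ((n - (s + t)) / 2) * (‖x - z‖ : ℂ) ^ (s + t - n)) := by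
    intro s t hs ht hst
    have h0 := integral_inv_gamma_norm (n := n) (a := s + t) (by simpa using hst) hd
    have hc : EqOn (fun u : ℝ => (u : ℂ) ^ ((s + t) / 2 - n / 2 - 1) *
        Complex.exp (-((‖x - z‖ ^ 2 : ℝ) / u)))
        (fun w : ℝ => (w : ℂ) ^ (s / 2 + t / 2 - 1) * g w) (Ioi 0) := by
      intro w hw
      have hw' : (w : ℂ) ≠ 0 := by exact_mod_cast (ne_of_gt hw)
      simp only [hg]
      rw [← mul_assoc, ← Complex.cpow_add _ _ hw']
      congr 2
      ring
    have h1 := integral_quadrant_beta (s := s / 2) (t := t / 2) (g := g)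
      (by simpa using hs) (by simpa using ht) hgm (h0.1.congr_fun hc measurableSet_Ioi)
    rw [← setIntegral_congr_fun measurableSet_Ioi hc, h0.2] at h1
    exact h1
  have hinner : ∀ p : ℝ × ℝ, 0 < p.1 → 0 < p.2 →
      Integrable (fun y => Φ (y, p)) ∧ ∫ y, Φ (y, p) = (Real.pi : ℂ) ^ ((n : ℂ) / 2) *
        ((p.1 : ℂ) ^ (a / 2 - 1) * (p.2 : ℂ) ^ (b / 2 - 1) * g (p.1 + p.2)) := by
    intro p h1 h2
    have h := gaussian_conv n x z h1 h2
    refine ⟨h.1.const_mul (P p), ?_⟩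
    simp only [hΦ, hG]
    rw [integral_const_mul, h.2]
    simp only [hP, hg]
    have h1' : (p.1 : ℂ) ≠ 0 := by exact_mod_cast h1.ne'
    have h2' : (p.2 : ℂ) ≠ 0 := by exact_mod_cast h2.ne'
    have e1 : (p.1 : ℂ) ^ (a / 2 - 1) =
        (p.1 : ℂ) ^ (a / 2 - n / 2 - 1) * (p.1 : ℂ) ^ ((n : ℂ) / 2) := by
      rw [← Complex.cpow_add _ _ h1']
      congr 1
      ring
    have e2 : (p.2 : ℂ) ^ (b / 2 - 1) =
        (p.2 : ℂ) ^ (b / 2 - n / 2 - 1) * (p.2 : ℂ) ^ ((n : ℂ) / 2) := by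
      rw [← Complex.cpow_add _ _ h2']
      congr 1
      ring
    rw [e1, e2]
    ring
  have hinner_norm : ∀ p : ℝ × ℝ, 0 < p.1 → 0 < p.2 →
      ∫ y, ‖Φ (y, p)‖ = ‖(Real.pi : ℂ) ^ ((n : ℂ) / 2) *
        ((p.1 : ℂ) ^ ((a.re : ℂ) / 2 - 1) * (p.2 : ℂ) ^ ((b.re : ℂ) / 2 - 1) *
          g (p.1 + p.2))‖ := by
    intro p h1 h2
    have hGn : ∀ y, G y p = ((Real.exp (-(‖x - y‖ ^ 2 / p.1)) *
        Real.exp (-(‖y - z‖ ^ 2 / p.2)) : ℝ) : ℂ) := by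
      intro y
      simp only [hG]
      push_cast
      rfl
    have hGnorm : ∀ y, ((‖G y p‖ : ℝ) : ℂ) = G y p := by
      intro y
      rw [hGn, Complex.norm_real, Real.norm_of_nonneg (by positivity)]
    have e : ∫ y, ‖Φ (y, p)‖ = ‖P p‖ * ∫ y, ‖G y p‖ := by
      rw [← integral_const_mul]
      simp only [hΦ, norm_mul]
    have e0 : ((∫ y, ‖G y p‖ : ℝ) : ℂ) = ∫ y, G y p := by
      rw [← integral_complex_ofReal]
      simp only [hGnorm]
    have e1 : ∫ y, ‖G y p‖ = ‖∫ y, G y p‖ := by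
      rw [← e0, Complex.norm_real, Real.norm_of_nonneg (integral_nonneg fun _ => norm_nonneg _)]
    have h := (gaussian_conv n x z h1 h2).2
    rw [e, e1]
    simp only [hG]
    rw [h, ← norm_mul]
    simp only [hP, hg, norm_mul]
    have h12 : 0 < p.1 + p.2 := add_pos h1 h2
    simp only [Complex.norm_cpow_eq_rpow_re_of_pos h1, Complex.norm_cpow_eq_rpow_re_of_pos h2,
      Complex.norm_cpow_eq_rpow_re_of_pos h12, Complex.norm_cpow_eq_rpow_re_of_pos Real.pi_pos]
    have e1 : p.1 ^ (((a.re : ℂ) / 2 - 1).re) =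
        p.1 ^ ((a / 2 - n / 2 - 1 : ℂ).re) * p.1 ^ (((n : ℂ) / 2).re) := by
      rw [← Real.rpow_add h1]
      congr 1
      simp only [Complex.sub_re, Complex.div_ofNat_re, Complex.ofReal_re, Complex.one_re,
        Complex.natCast_re]
      ring
    have e2 : p.2 ^ (((b.re : ℂ) / 2 - 1).re) =
        p.2 ^ ((b / 2 - n / 2 - 1 : ℂ).re) * p.2 ^ (((n : ℂ) / 2).re) := by
      rw [← Real.rpow_add h2]
      congr 1
      simp only [Complex.sub_re, Complex.div_ofNat_re, Complex.ofReal_re, Complex.one_re,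
        Complex.natCast_re]
      ring
    rw [e1, e2]
    ring
  have hΦI : Integrable Φ (volume.prod ν) := by
    rw [integrable_prod_iff' hΦm.aestronglyMeasurable]
    refine ⟨hae.mono fun p hp => (hinner p hp.1 hp.2).1, ?_⟩
    have h := (hbeta (s := a.re) (t := b.re) (by simpa using ha) (by simpa using hb)
      (by simpa using hab)).1
    refine ((h.const_mul ((Real.pi : ℂ) ^ ((n : ℂ) / 2))).norm).congr ?_
    exact hae.mono fun p hp => (hinner_norm p hp.1 hp.2).symm
  have hΦval : ∫ q, Φ q ∂(volume.prod ν) = (Real.pi : ℂ) ^ ((n : ℂ) / 2) *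
      ((a / 2).betaIntegral (b / 2) *
        (Complex.Gamma ((n - (a + b)) / 2) * (‖x - z‖ : ℂ) ^ (a + b - n))) := by
    rw [integral_prod_symm _ hΦI, ← (hbeta ha hb hab).2, ← integral_const_mul]
    exact integral_congr_ae (hae.mono fun p hp => (hinner p hp.1 hp.2).2)
  have hyae : ∀ᵐ y : EuclideanSpace ℝ (Fin n), y ≠ x ∧ y ≠ z :=
    (Measure.ae_ne volume x).and (Measure.ae_ne volume z)
  have houter : ∀ᵐ y : EuclideanSpace ℝ (Fin n), ∫ p, Φ (y, p) ∂ν =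
      Complex.Gamma ((n - a) / 2) * Complex.Gamma ((n - b) / 2) *
        ((‖x - y‖ : ℂ) ^ (a - n) * (‖y - z‖ : ℂ) ^ (b - n)) := by
    filter_upwards [hyae] with y hy
    have h1 := (integral_inv_gamma_norm han (norm_pos_iff.2 (sub_ne_zero.2 hy.1.symm))).2
    have h2 := (integral_inv_gamma_norm hbn (norm_pos_iff.2 (sub_ne_zero.2 hy.2))).2
    have h3 := integral_prod_mul (μ := volume.restrict (Ioi (0 : ℝ)))
      (ν := volume.restrict (Ioi (0 : ℝ)))
      (fun u : ℝ => (u : ℂ) ^ (a / 2 - n / 2 - 1) * Complex.exp (-((‖x - y‖ ^ 2 : ℝ) / u)))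
      (fun u : ℝ => (u : ℂ) ^ (b / 2 - n / 2 - 1) * Complex.exp (-((‖y - z‖ ^ 2 : ℝ) / u)))
    rw [h1, h2] at h3
    rw [mul_mul_mul_comm, ← h3]
    refine integral_congr_ae (Eventually.of_forall fun p => ?_)
    simp only [hΦ, hP, hG]
    ring
  have g1 : Complex.Gamma ((n - a) / 2) ≠ 0 :=
    Complex.Gamma_ne_zero_of_re_pos (by simp; linarith)
  have g2 : Complex.Gamma ((n - b) / 2) ≠ 0 :=
    Complex.Gamma_ne_zero_of_re_pos (by simp; linarith)
  have hI := (hΦI.integral_prod_left.congr houter)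
  refine ⟨?_, ?_⟩
  · have := hI.const_mul (Complex.Gamma ((n - a) / 2) * Complex.Gamma ((n - b) / 2))⁻¹
    simpa only [inv_mul_cancel_left₀ (mul_ne_zero g1 g2)] using this
  · rw [integral_prod _ hΦI, integral_congr_ae houter, integral_const_mul] at hΦval
    have hH : Hfun n (a + b) ≠ 0 := Hfun_ne_zero (by simp; linarith) (by simpa using hab)
    rw [Hfun_mul ha hb hab]
    field_simp
    linear_combination hΦval

lemma norm_kernel {n : ℕ} {a : ℂ} (han : a.re < n) {r : ℝ} (hr : 0 ≤ r) :
    ‖(r : ℂ) ^ (a - n)‖ = r ^ (a.re - n) := by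
  have h : (a - n : ℂ).re = a.re - n := by simp
  rw [Complex.norm_cpow_eq_rpow_re_of_nonneg hr (by rw [h]; linarith), h]

lemma kernel_ofReal {n : ℕ} (σ : ℝ) {r : ℝ} (hr : 0 ≤ r) :
    (r : ℂ) ^ ((σ : ℂ) - n) = ((r ^ (σ - n) : ℝ) : ℂ) := by
  rw [Complex.ofReal_cpow hr]
  push_cast
  rfl

lemma integral_norm_kernel_mul_kernel {n : ℕ} {a b : ℂ} (ha : 0 < a.re) (hb : 0 < b.re)
    (hab : a.re + b.re < n) {x z : EuclideanSpace ℝ (Fin n)} (hxz : x ≠ z) :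
    ∫ y, ‖(‖x - y‖ : ℂ) ^ (a - n) * (‖y - z‖ : ℂ) ^ (b - n)‖ =
      ‖Hfun n a.re * Hfun n b.re * (Hfun n (a.re + b.re))⁻¹ *
        (‖x - z‖ : ℂ) ^ ((a.re + b.re : ℂ) - n)‖ := by
  have h := (integral_kernel_mul_kernel (a := a.re) (b := b.re) (by simpa using ha)
    (by simpa using hb) (by simpa using hab) hxz).2
  rw [← h]
  have e : ∀ y : EuclideanSpace ℝ (Fin n),
      (‖x - y‖ : ℂ) ^ ((a.re : ℂ) - n) * (‖y - z‖ : ℂ) ^ ((b.re : ℂ) - n) =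
        ((‖(‖x - y‖ : ℂ) ^ (a - n) * (‖y - z‖ : ℂ) ^ (b - n)‖ : ℝ) : ℂ) := by
    intro y
    rw [norm_mul, norm_kernel (by linarith) (norm_nonneg _),
      norm_kernel (by linarith) (norm_nonneg _), kernel_ofReal _ (norm_nonneg _),
      kernel_ofReal _ (norm_nonneg _)]
    push_cast
    rfl
  simp_rw [e]
  rw [integral_complex_ofReal, Complex.norm_real,
    Real.norm_of_nonneg (integral_nonneg fun _ => norm_nonneg _)]

lemma exists_norm_le_of_isBigO_cocompact {n : ℕ} {f : EuclideanSpace ℝ (Fin n) → ℂ}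
    (hf : Continuous f) {m : ℝ} (hm : 0 < m)
    (hO : f =O[cocompact (EuclideanSpace ℝ (Fin n))] fun y => ‖y‖ ^ (-m))
    (x : EuclideanSpace ℝ (Fin n)) :
    ∃ C, ∀ y, ‖f y‖ ≤ C * (1 + ‖x - y‖) ^ (-m) := by
  have hcont : Continuous fun y => ‖f y‖ * (1 + ‖x - y‖) ^ m := by
    refine hf.norm.mul (Continuous.rpow_const (by fun_prop) fun y => Or.inr hm.le)
  obtain ⟨c, hc0, hc⟩ := hO.exists_pos
  have hlarge : ∀ᶠ y in cocompact (EuclideanSpace ℝ (Fin n)), 1 + ‖x‖ ≤ ‖y‖ :=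
    (tendsto_norm_cocompact_atTop).eventually_ge_atTop _
  have hev : ∀ᶠ y in cocompact (EuclideanSpace ℝ (Fin n)),
      ‖f y‖ * (1 + ‖x - y‖) ^ m ≤ c * 2 ^ m := by
    filter_upwards [hlarge, hc.bound] with y hy hfy
    have hy0 : 0 < ‖y‖ := by linarith [norm_nonneg x]
    have h1 : 1 + ‖x - y‖ ≤ 2 * ‖y‖ := by linarith [norm_sub_le x y]
    have h2 : (1 + ‖x - y‖) ^ m ≤ 2 ^ m * ‖y‖ ^ m := by
      rw [← Real.mul_rpow (by norm_num) hy0.le]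
      exact Real.rpow_le_rpow (by positivity) h1 hm.le
    rw [Real.norm_of_nonneg (by positivity)] at hfy
    calc ‖f y‖ * (1 + ‖x - y‖) ^ m ≤ (c * ‖y‖ ^ (-m)) * (2 ^ m * ‖y‖ ^ m) := by gcongr
      _ = c * 2 ^ m * (‖y‖ ^ (-m) * ‖y‖ ^ m) := by ring
      _ = c * 2 ^ m := by rw [← Real.rpow_add hy0]; simp
  obtain ⟨K, hK, hKs⟩ := mem_cocompact.1 hev
  obtain ⟨D, hD⟩ := (hK.image hcont).bddAbove
  refine ⟨max D (c * 2 ^ m), fun y => ?_⟩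
  have hpos : 0 < 1 + ‖x - y‖ := by positivity
  have key : ‖f y‖ * (1 + ‖x - y‖) ^ m ≤ max D (c * 2 ^ m) := by
    by_cases hy : y ∈ K
    · exact (hD (mem_image_of_mem _ hy)).trans (le_max_left _ _)
    · exact (hKs hy : _ ≤ _).trans (le_max_right _ _)
  rw [Real.rpow_neg hpos.le, ← div_eq_mul_inv, le_div_iff₀ (by positivity)]
  exact key

lemma integrable_radial_kernel {n : ℕ} (hn : 0 < n) {m σ : ℝ} (hσ : 0 < σ) (hσm : σ < m)
    (x : EuclideanSpace ℝ (Fin n)) :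
    Integrable fun y => (1 + ‖x - y‖) ^ (-m) * ‖x - y‖ ^ (σ - n) := by
  have : Nonempty (Fin n) := ⟨⟨0, hn⟩⟩
  have hmel : IntegrableOn (fun t : ℝ => t ^ (σ - 1) * (1 + t) ^ (-m)) (Ioi 0) := by
    refine mellin_convergent_of_isBigO_scalar (a := m) (b := 0) ?_ ?_ hσm ?_ hσ
    · refine ContinuousOn.locallyIntegrableOn ?_ measurableSet_Ioi
      exact ContinuousOn.rpow_const (by fun_prop) fun t ht => Or.inl (by
        have : 0 < t := ht
        positivity)
    · refine IsBigO.of_bound 1 ((eventually_gt_atTop 0).mono fun t ht => ?_)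
      rw [Real.norm_of_nonneg (by positivity), Real.norm_of_nonneg (by positivity), one_mul]
      exact Real.rpow_le_rpow_of_nonpos ht (by linarith) (by linarith)
    · refine IsBigO.of_bound 1 (eventually_nhdsWithin_of_forall fun t ht => ?_)
      have ht : 0 < t := ht
      rw [Real.norm_of_nonneg (by positivity)]
      simpa using Real.rpow_le_one_of_one_le_of_nonpos (by linarith : 1 ≤ 1 + t)
        (by linarith : -m ≤ 0)
  have h := (integrable_fun_norm_addHaar (volume : Measure (EuclideanSpace ℝ (Fin n)))
    (f := fun t : ℝ => (1 + t) ^ (-m) * t ^ (σ - n))).2 (by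
      refine hmel.congr_fun (fun t ht => ?_) measurableSet_Ioi
      have ht : 0 < t := ht
      simp only [finrank_euclideanSpace, Fintype.card_fin, smul_eq_mul]
      rw [← Real.rpow_natCast, mul_left_comm, ← Real.rpow_add ht, mul_comm,
        Nat.cast_sub (Nat.one_le_of_lt hn)]
      congr 2
      push_cast
      ring)
  exact h.comp_sub_left x

lemma integrable_mul_kernel {n : ℕ} {f : EuclideanSpace ℝ (Fin n) → ℂ}
    (hf : Continuous f) {m : ℝ} (hmn : m ≤ n)
    (hO : f =O[cocompact (EuclideanSpace ℝ (Fin n))] fun y => ‖y‖ ^ (-m))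
    {β : ℂ} (hβ : 0 < β.re) (hβm : β.re < m) (x : EuclideanSpace ℝ (Fin n)) :
    Integrable fun y => f y * (‖x - y‖ : ℂ) ^ (β - n) := by
  have hn : 0 < n := by
    have : (0 : ℝ) < n := by linarith
    exact_mod_cast this
  obtain ⟨C, hC⟩ := exists_norm_le_of_isBigO_cocompact hf (hβ.trans hβm) hO x
  refine ((integrable_radial_kernel hn hβ hβm x).const_mul C).mono' ?_
    (Eventually.of_forall fun y => ?_)
  · have hfm := hf.measurable
    exact (by fun_prop : Measurable fun y => f y * (‖x - y‖ : ℂ) ^ (β - n)).aestronglyMeasurable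
  · rw [norm_mul, norm_kernel (by linarith) (norm_nonneg _), ← mul_assoc]
    gcongr
    exact hC y

/-- The semigroup property `I^a (I^b f) = I^(a+b) f`. -/
lemma riesz_riesz {n : ℕ} {f : EuclideanSpace ℝ (Fin n) → ℂ}
    (hf : Continuous f) {m : ℝ} (hmn : m ≤ n)
    (hO : f =O[cocompact (EuclideanSpace ℝ (Fin n))] fun y => ‖y‖ ^ (-m))
    {a b : ℂ} (ha : 0 < a.re) (hb : 0 < b.re) (hab : a.re + b.re < m)
    (x : EuclideanSpace ℝ (Fin n)) :
    riesz n (riesz n f b) a x = riesz n f (a + b) x := by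
  have habn : a.re + b.re < n := by linarith
  have hn : 0 < n := by
    have : (0 : ℝ) < n := by linarith
    exact_mod_cast this
  have : NeZero n := ⟨hn.ne'⟩
  have hfm := hf.measurable
  set Ψ : EuclideanSpace ℝ (Fin n) → EuclideanSpace ℝ (Fin n) → ℂ := fun z y =>
    f z * ((‖x - y‖ : ℂ) ^ (a - n) * (‖y - z‖ : ℂ) ^ (b - n)) with hΨ
  have hzae : ∀ᵐ z : EuclideanSpace ℝ (Fin n), x ≠ z :=
    (Measure.ae_ne volume x).mono fun z hz => hz.symm
  have hΨm : Measurable (Function.uncurry Ψ) := by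
    simp only [hΨ, Function.uncurry_def]
    fun_prop
  have hI : Integrable (Function.uncurry Ψ) (volume.prod volume) := by
    rw [integrable_prod_iff hΨm.aestronglyMeasurable]
    refine ⟨hzae.mono fun z hz => (integral_kernel_mul_kernel ha hb habn hz).1.const_mul (f z), ?_⟩
    have h := (integrable_mul_kernel hf hmn hO (β := a.re + b.re) (by simpa using add_pos ha hb)
      (by simpa using hab) x).mul_const (Hfun n a.re * Hfun n b.re * (Hfun n (a.re + b.re))⁻¹)
    refine h.norm.congr (hzae.mono fun z hz => ?_)
    simp only [Function.uncurry_apply_pair, hΨ, norm_mul (f z)]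
    rw [integral_const_mul, integral_norm_kernel_mul_kernel ha hb habn hz, ← norm_mul]
    congr 1
    ring
  have hswap := integral_integral_swap hI
  have h1 : ∫ z, ∫ y, Ψ z y = Hfun n a * Hfun n b * (Hfun n (a + b))⁻¹ *
      ∫ z, f z * (‖x - z‖ : ℂ) ^ (a + b - n) := by
    rw [← integral_const_mul]
    refine integral_congr_ae (hzae.mono fun z hz => ?_)
    simp only [hΨ]
    rw [integral_const_mul, (integral_kernel_mul_kernel ha hb habn hz).2]
    ring
  have h2 : ∫ y, ∫ z, Ψ z y =
      Hfun n b * ∫ y, riesz n f b y * (‖x - y‖ : ℂ) ^ (a - n) := by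
    rw [← integral_const_mul]
    congr 1
    ext y
    simp only [hΨ, riesz]
    rw [← mul_assoc, mul_inv_cancel_left₀ (Hfun_ne_zero hb (by linarith)), ← integral_mul_const]
    congr 1
    ext z
    ring
  have hHa := Hfun_ne_zero (n := n) ha (by linarith)
  have hHb := Hfun_ne_zero (n := n) hb (by linarith)
  rw [h1, h2] at hswap
  rw [riesz, riesz]
  refine mul_left_cancel₀ (mul_ne_zero hHa hHb) ?_
  rw [← mul_assoc, mul_right_comm (Hfun n a), mul_inv_cancel₀ hHa, one_mul, ← hswap]
  ring

lemma abs_log_le_rpow {ε r : ℝ} (hε : 0 < ε) (hr : 0 < r) :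
    |Real.log r| ≤ (r ^ ε + r ^ (-ε)) / ε := by
  have h1 := Real.log_le_rpow_div hr.le hε
  have h2 := Real.log_le_rpow_div (inv_pos.2 hr).le hε
  rw [Real.log_inv, Real.inv_rpow hr.le, ← Real.rpow_neg hr.le] at h2
  have p1 : 0 ≤ r ^ ε / ε := by positivity
  have p2 : 0 ≤ r ^ (-ε) / ε := by positivity
  rw [add_div, abs_le]
  constructor <;> linarith

lemma rpow_le_rpow_add_rpow {r p q t : ℝ} (hr : 0 < r) (h1 : p ≤ t) (h2 : t ≤ q) :
    r ^ t ≤ r ^ q + r ^ p := by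
  rcases le_total 1 r with h | h
  · exact (Real.rpow_le_rpow_of_exponent_le h h2).trans
      (le_add_of_nonneg_right (by positivity))
  · exact (Real.rpow_le_rpow_of_exponent_ge hr h h1).trans
      (le_add_of_nonneg_left (by positivity))

lemma differentiableAt_integral_kernel {n : ℕ} {f : EuclideanSpace ℝ (Fin n) → ℂ}
    (hf : Continuous f) {m : ℝ} (hmn : m ≤ n)
    (hO : f =O[cocompact (EuclideanSpace ℝ (Fin n))] fun y => ‖y‖ ^ (-m))
    {β₀ : ℂ} (hβ : 0 < β₀.re) (hβm : β₀.re < m) (x : EuclideanSpace ℝ (Fin n)) :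
    DifferentiableAt ℂ (fun β : ℂ => ∫ y, f y * (‖x - y‖ : ℂ) ^ (β - n)) β₀ := by
  have hn : 0 < n := by
    have : (0 : ℝ) < n := by linarith
    exact_mod_cast this
  have : NeZero n := ⟨hn.ne'⟩
  have hfm := hf.measurable
  obtain ⟨ε, hε, he1, he2⟩ : ∃ ε : ℝ, 0 < ε ∧ 0 < β₀.re - 2 * ε ∧ β₀.re + 2 * ε < m := by
    obtain ⟨e, he0, he⟩ := exists_between (lt_min (half_pos hβ) (half_pos (sub_pos.2 hβm)))
    have := lt_min_iff.1 he
    exact ⟨e, he0, by linarith [this.1], by linarith [this.2]⟩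
  have hreal : ∀ σ : ℝ, 0 < σ → σ < m → Integrable fun y => ‖f y‖ * ‖x - y‖ ^ (σ - n) := by
    intro σ h0 h1
    have h := (integrable_mul_kernel hf hmn hO (β := σ) (by simpa using h0) (by simpa using h1)
      x).norm
    refine h.congr (Eventually.of_forall fun y => ?_)
    simp only [norm_mul]
    rw [norm_kernel (by simp; linarith) (norm_nonneg _), Complex.ofReal_re]
  have hae : ∀ᵐ y : EuclideanSpace ℝ (Fin n), 0 < ‖x - y‖ :=
    (Measure.ae_ne volume x).mono fun y hy => norm_pos_iff.2 (sub_ne_zero.2 hy.symm)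
  refine (hasDerivAt_integral_of_dominated_loc_of_deriv_le
    (F' := fun β y => f y * ((‖x - y‖ : ℂ) ^ (β - n) * Complex.log (‖x - y‖ : ℂ)))
    (bound := fun y => (‖f y‖ * ‖x - y‖ ^ (β₀.re + 2 * ε - n) +
      2 * (‖f y‖ * ‖x - y‖ ^ (β₀.re - n)) + ‖f y‖ * ‖x - y‖ ^ (β₀.re - 2 * ε - n)) / ε)
    (Metric.ball_mem_nhds β₀ hε) ?_ ?_ ?_ ?_ ?_ ?_).2.differentiableAt
  · exact Eventually.of_forall fun β =>
      (by fun_prop : Measurable fun y => f y * (‖x - y‖ : ℂ) ^ (β - n)).aestronglyMeasurable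
  · exact integrable_mul_kernel hf hmn hO hβ hβm x
  · exact (by fun_prop : Measurable fun y => f y * ((‖x - y‖ : ℂ) ^ (β₀ - n) *
      Complex.log (‖x - y‖ : ℂ))).aestronglyMeasurable
  · filter_upwards [hae] with y hy β hβb
    have hd : |β.re - β₀.re| < ε := by
      rw [mem_ball_iff_norm] at hβb
      have := (Complex.abs_re_le_norm (β - β₀)).trans_lt hβb
      simpa using this
    obtain ⟨hd1, hd2⟩ := abs_lt.1 hd
    rw [norm_mul, norm_mul, Complex.norm_cpow_eq_rpow_re_of_pos hy, ← Complex.ofReal_log hy.le,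
      Complex.norm_real, Real.norm_eq_abs]
    have hlog := abs_log_le_rpow hε hy
    have hpow := rpow_le_rpow_add_rpow (t := (β - n : ℂ).re) (p := β₀.re - ε - n)
      (q := β₀.re + ε - n) hy (by simp; linarith) (by simp; linarith)
    set r := ‖x - y‖
    have e1 : r ^ (β₀.re + 2 * ε - n) = r ^ (β₀.re + ε - n) * r ^ ε := by
      rw [← Real.rpow_add hy]; congr 1; ring
    have e2 : r ^ (β₀.re - n) = r ^ (β₀.re + ε - n) * r ^ (-ε) := by
      rw [← Real.rpow_add hy]; congr 1; ring
    have e3 : r ^ (β₀.re - n) = r ^ (β₀.re - ε - n) * r ^ ε := by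
      rw [← Real.rpow_add hy]; congr 1; ring
    have e4 : r ^ (β₀.re - 2 * ε - n) = r ^ (β₀.re - ε - n) * r ^ (-ε) := by
      rw [← Real.rpow_add hy]; congr 1; ring
    calc ‖f y‖ * (r ^ (β - n : ℂ).re * |Real.log r|)
        ≤ ‖f y‖ * ((r ^ (β₀.re + ε - n) + r ^ (β₀.re - ε - n)) * ((r ^ ε + r ^ (-ε)) / ε)) := by
          gcongr
      _ = _ := by
          rw [e1, e4]
          linear_combination (-(‖f y‖ / ε)) * (e2 + e3)
  · exact (((hreal _ (by linarith) he2).add ((hreal _ hβ hβm).const_mul 2)).add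
      (hreal _ he1 (by linarith))).div_const ε
  · filter_upwards [hae] with y hy β _
    have hy' : (‖x - y‖ : ℂ) ≠ 0 := by exact_mod_cast hy.ne'
    have h := ((hasDerivAt_id' β).sub_const (n : ℂ)).const_cpow (c := (‖x - y‖ : ℂ)) (Or.inl hy')
    simpa using h.const_mul (f y)

lemma differentiableAt_inv_Hfun {n : ℕ} {β : ℂ} (hβn : β.re < n) :
    DifferentiableAt ℂ (fun β => (Hfun n β)⁻¹) β := by
  have he : (fun β => (Hfun n β)⁻¹) = fun β : ℂ => Complex.Gamma ((n - β) / 2) *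
      ((2 : ℂ) ^ (-β) * ((Real.pi : ℂ) ^ ((n : ℂ) / 2))⁻¹ * (Complex.Gamma (β / 2))⁻¹) := by
    ext β
    rw [Hfun, inv_div, div_eq_mul_inv, mul_inv, mul_inv, Complex.cpow_neg]
  rw [he]
  refine DifferentiableAt.mul ?_ ((DifferentiableAt.mul_const ?_ _).mul ?_)
  · refine DifferentiableAt.comp (g := Complex.Gamma) β
      (Complex.differentiableAt_Gamma _ fun j hj => ?_) (by fun_prop)
    have h := congrArg Complex.re hj
    simp at h
    have : (0 : ℝ) ≤ j := j.cast_nonneg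
    linarith
  · exact (differentiableAt_id.neg).const_cpow (Or.inl two_ne_zero)
  · exact DifferentiableAt.comp (g := fun s => (Complex.Gamma s)⁻¹) β
      (Complex.differentiable_one_div_Gamma _) (by fun_prop)

lemma differentiableAt_riesz {n : ℕ} {f : EuclideanSpace ℝ (Fin n) → ℂ}
    (hf : Continuous f) {m : ℝ} (hmn : m ≤ n)
    (hO : f =O[cocompact (EuclideanSpace ℝ (Fin n))] fun y => ‖y‖ ^ (-m))
    {β : ℂ} (hβ : 0 < β.re) (hβm : β.re < m) (x : EuclideanSpace ℝ (Fin n)) :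
    DifferentiableAt ℂ (fun β : ℂ => riesz n f β x) β :=
  (differentiableAt_inv_Hfun (by linarith)).mul
    (differentiableAt_integral_kernel hf hmn hO hβ hβm x)

/-- `H_n(s)⁻¹` for real `s`. -/
noncomputable def invHfunReal (n : ℕ) (s : ℝ) : ℝ :=
  Real.Gamma ((n - s) / 2) / (2 ^ s * Real.pi ^ ((n : ℝ) / 2) * Real.Gamma (s / 2))

lemma inv_Hfun_ofReal (n : ℕ) (s : ℝ) : (Hfun n s)⁻¹ = (invHfunReal n s : ℂ) := by
  have e1 : ((n : ℂ) - s) / 2 = (((n - s) / 2 : ℝ) : ℂ) := by push_cast; rfl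
  have e2 : (s : ℂ) / 2 = ((s / 2 : ℝ) : ℂ) := by push_cast; rfl
  have e3 : (n : ℂ) / 2 = ((n / 2 : ℝ) : ℂ) := by push_cast; rfl
  have e4 : (2 : ℂ) = ((2 : ℝ) : ℂ) := by norm_cast
  rw [Hfun, inv_div, invHfunReal, e1, e2, e3, Complex.Gamma_ofReal, Complex.Gamma_ofReal,
    ← Complex.ofReal_cpow Real.pi_pos.le]
  nth_rewrite 1 [e4]
  rw [← Complex.ofReal_cpow two_pos.le]
  push_cast
  rfl

lemma invHfunReal_nonneg {n : ℕ} {s : ℝ} (hs : 0 < s) (hsn : s < n) : 0 ≤ invHfunReal n s := by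
  have h1 : 0 < Real.Gamma ((n - s) / 2) := Real.Gamma_pos_of_pos (by linarith)
  have h2 : 0 < Real.Gamma (s / 2) := Real.Gamma_pos_of_pos (by linarith)
  rw [invHfunReal]
  positivity

lemma tendsto_invHfunReal_div {n : ℕ} (hn : 0 < n) :
    Tendsto (fun s => invHfunReal n s / s) (nhdsWithin 0 (Ioi 0))
      (nhds (Real.Gamma (n / 2) / (2 * Real.pi ^ ((n : ℝ) / 2)))) := by
  have hn' : (0 : ℝ) < n := by exact_mod_cast hn
  have hΓ : ∀ t : ℝ, 0 < t → ContinuousAt Real.Gamma t := fun t ht =>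
    (Real.differentiableAt_Gamma fun j hj => by
      have : (0 : ℝ) ≤ j := j.cast_nonneg
      linarith).continuousAt
  have hcont : ContinuousAt (fun s : ℝ => Real.Gamma ((n - s) / 2) /
      (2 ^ s * Real.pi ^ ((n : ℝ) / 2) * (2 * Real.Gamma (s / 2 + 1)))) 0 := by
    refine ContinuousAt.div ?_ ?_ ?_
    · exact ContinuousAt.comp (g := Real.Gamma) (hΓ _ (by simpa using hn')) (by fun_prop)
    · refine (ContinuousAt.mul ?_ continuousAt_const).mul (continuousAt_const.mul ?_)
      · exact (Real.continuous_const_rpow two_ne_zero).continuousAt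
      · exact ContinuousAt.comp (g := Real.Gamma) (hΓ _ (by simp)) (by fun_prop)
    · have : 0 < Real.pi ^ ((n : ℝ) / 2) := Real.rpow_pos_of_pos Real.pi_pos _
      simp [this.ne']
  have h := hcont.tendsto.mono_left (nhdsWithin_le_nhds (s := Ioi 0))
  simp only [sub_zero, Real.rpow_zero, one_mul, zero_div, zero_add, Real.Gamma_one, mul_one] at h
  rw [mul_comm 2]
  refine h.congr' (eventually_nhdsWithin_of_forall fun s hs => ?_)
  have hs : 0 < s := hs
  simp only [invHfunReal]
  rw [Real.Gamma_add_one (half_pos hs).ne', div_div]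
  congr 1
  ring

lemma tendsto_invHfunReal {n : ℕ} (hn : 0 < n) :
    Tendsto (invHfunReal n) (nhdsWithin 0 (Ioi 0)) (nhds 0) := by
  have h := (tendsto_invHfunReal_div hn).mul
    (tendsto_id.mono_left (nhdsWithin_le_nhds (a := (0 : ℝ)) (s := Ioi 0)))
  rw [mul_zero] at h
  refine h.congr' (eventually_nhdsWithin_of_forall fun s hs => ?_)
  simp only [id]
  exact div_mul_cancel₀ _ (ne_of_gt hs)

lemma setIntegral_ball_norm_rpow {n : ℕ} (hn : 0 < n) {s : ℝ} (hs : 0 < s)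
    (x : EuclideanSpace ℝ (Fin n)) :
    ∫ y in ball x 1, ‖x - y‖ ^ (s - n) =
      2 * Real.pi ^ ((n : ℝ) / 2) / Real.Gamma (n / 2) / s := by
  have : Nonempty (Fin n) := ⟨⟨0, hn⟩⟩
  set h : ℝ → ℝ := indicator (Iio 1) fun r => r ^ (s - n) with hh
  have e1 : ∫ y in ball x 1, ‖x - y‖ ^ (s - n) = ∫ y, h ‖x - y‖ := by
    rw [← integral_indicator measurableSet_ball]
    congr 1
    ext y
    simp only [hh, indicator, mem_ball, mem_Iio, dist_comm y x, dist_eq_norm]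
  have e2 : ∫ y in Ioi (0 : ℝ), y ^ (n - 1) • h y = 1 / s := by
    have : EqOn (fun y : ℝ => y ^ (n - 1) • h y)
        (indicator (Iio 1) fun r : ℝ => r ^ (s - 1)) (Ioi 0) := by
      intro r hr
      have hr : 0 < r := hr
      simp only [hh, indicator, smul_eq_mul, mem_Iio]
      split_ifs
      · rw [← Real.rpow_natCast, ← Real.rpow_add hr, Nat.cast_sub (Nat.one_le_of_lt hn)]
        congr 1
        push_cast
        ring
      · simp
    rw [setIntegral_congr_fun measurableSet_Ioi this, setIntegral_indicator measurableSet_Iio,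
      Ioi_inter_Iio, ← integral_Ioc_eq_integral_Ioo,
      ← intervalIntegral.integral_of_le zero_le_one, integral_rpow (Or.inl (by linarith))]
    simp [hs.ne']
  rw [e1, integral_sub_left_eq_self (fun y => h ‖y‖) volume x, integral_fun_norm_addHaar,
    finrank_euclideanSpace, Fintype.card_fin, e2, Measure.real, EuclideanSpace.volume_ball]
  have hG : 0 < Real.Gamma ((n : ℝ) / 2) := Real.Gamma_pos_of_pos (by positivity)
  have hn' : (n : ℝ) ≠ 0 := by exact_mod_cast hn.ne'
  have hsq : √Real.pi ^ n = Real.pi ^ ((n : ℝ) / 2) := by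
    rw [Real.sqrt_eq_rpow, ← Real.rpow_natCast, ← Real.rpow_mul Real.pi_pos.le]
    congr 1
    ring
  rw [Fintype.card_fin, Real.Gamma_add_one (by positivity), hsq]
  simp only [ENNReal.ofReal_one, one_pow, one_mul, nsmul_eq_mul, smul_eq_mul]
  rw [ENNReal.toReal_ofReal (by positivity)]
  field_simp

lemma tendsto_riesz_zero {n : ℕ} {f : EuclideanSpace ℝ (Fin n) → ℂ}
    (hf : Continuous f) {m : ℝ} (hm : 0 < m) (hmn : m ≤ n)
    (hO : f =O[cocompact (EuclideanSpace ℝ (Fin n))] fun y => ‖y‖ ^ (-m))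
    (x : EuclideanSpace ℝ (Fin n)) :
    Tendsto (fun s : ℝ => riesz n f s x) (nhdsWithin 0 (Ioi 0)) (nhds (f x)) := by
  have hn' : (0 : ℝ) < n := by linarith
  have hn : 0 < n := by exact_mod_cast hn'
  have hsmall : ∀ c : ℝ, 0 < c → ∀ᶠ s in nhdsWithin (0 : ℝ) (Ioi 0), 0 < s ∧ s < c := fun c hc =>
    (eventually_nhdsWithin_of_forall fun s hs => hs).and
      (eventually_nhdsWithin_of_eventually_nhds (eventually_lt_nhds hc))
  have hzero := tendsto_invHfunReal hn
  have hball : Tendsto (fun s : ℝ => ∫ y in ball x 1,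
      (invHfunReal n s * ‖x - y‖ ^ (s - n)) • f y) (nhdsWithin 0 (Ioi 0)) (nhds (f x)) := by
    refine tendsto_setIntegral_peak_smul_of_integrableOn_of_tendsto (x₀ := x)
      (φ := fun s y => invHfunReal n s * ‖x - y‖ ^ (s - n))
      measurableSet_ball measurableSet_ball subset_rfl self_mem_nhdsWithin measure_ball_lt_top.ne
      ?_ ?_ ?_ ?_ ?_ ?_
    · filter_upwards [hsmall n hn'] with s hs y _
      exact mul_nonneg (invHfunReal_nonneg hs.1 hs.2) (by positivity)
    · intro u hu hxu
      obtain ⟨ε, hε, hεu⟩ := Metric.isOpen_iff.1 hu x hxu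
      have hlim : Tendsto (fun s => invHfunReal n s * ε ^ (-(n : ℝ)) * max 1 ε ^ (1 : ℝ))
          (nhdsWithin 0 (Ioi 0)) (nhds 0) := by
        simpa using (hzero.mul_const (ε ^ (-(n : ℝ)))).mul_const (max 1 ε ^ (1 : ℝ))
      rw [Metric.tendstoUniformlyOn_iff]
      intro η hη
      filter_upwards [hsmall n hn', hsmall 1 one_pos, hlim.eventually_lt_const hη]
        with s hs hs1 hlt y hy
      have hxy : ε ≤ ‖x - y‖ := by
        by_contra hcon
        exact hy.2 (hεu (by rw [mem_ball, dist_comm, dist_eq_norm]; linarith))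
      have hH := invHfunReal_nonneg hs.1 hs.2
      simp only [Pi.zero_apply]
      rw [dist_zero_left, Real.norm_of_nonneg (by positivity)]
      refine lt_of_le_of_lt ?_ hlt
      rw [mul_assoc]
      refine mul_le_mul_of_nonneg_left ?_ hH
      calc ‖x - y‖ ^ (s - n) ≤ ε ^ (s - n) :=
            Real.rpow_le_rpow_of_nonpos hε hxy (by linarith [hs.2])
        _ = ε ^ (-(n : ℝ)) * ε ^ s := by rw [← Real.rpow_add hε]; congr 1; ring
        _ ≤ ε ^ (-(n : ℝ)) * max 1 ε ^ (1 : ℝ) := by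
            refine mul_le_mul_of_nonneg_left ?_ (by positivity)
            exact (Real.rpow_le_rpow hε.le (le_max_right 1 ε) hs.1.le).trans
              (Real.rpow_le_rpow_of_exponent_le (le_max_left 1 ε) hs1.2.le)
    · have h := (tendsto_invHfunReal_div hn).mul_const
        (2 * Real.pi ^ ((n : ℝ) / 2) / Real.Gamma (n / 2))
      have hG : 0 < Real.Gamma ((n : ℝ) / 2) := Real.Gamma_pos_of_pos (by positivity)
      have hpi : 0 < Real.pi ^ ((n : ℝ) / 2) := Real.rpow_pos_of_pos Real.pi_pos _
      rw [div_mul_div_cancel₀' (by positivity), div_self (by positivity)] at h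
      refine h.congr' (eventually_nhdsWithin_of_forall fun s hs => ?_)
      simp only
      rw [integral_const_mul, setIntegral_ball_norm_rpow hn hs]
      ring
    · exact Eventually.of_forall fun s => (by fun_prop : Measurable fun y =>
        invHfunReal n s * ‖x - y‖ ^ (s - n)).aestronglyMeasurable
    · exact (hf.continuousOn.integrableOn_compact (isCompact_closedBall x 1)).mono_set
        ball_subset_closedBall
    · exact hf.continuousAt.continuousWithinAt
  have hI : ∀ s : ℝ, 0 < s → s < m → Integrable fun y => f y * (‖x - y‖ : ℂ) ^ ((s : ℂ) - n) :=
    fun s h0 h1 => integrable_mul_kernel hf hmn hO (by simpa using h0) (by simpa using h1) x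
  have hcompl : Tendsto (fun s : ℝ => (invHfunReal n s : ℂ) *
      ∫ y in (ball x 1)ᶜ, f y * (‖x - y‖ : ℂ) ^ ((s : ℂ) - n)) (nhdsWithin 0 (Ioi 0)) (nhds 0) := by
    have hm2 := hI (m / 2) (by linarith) (by linarith)
    set D := ∫ y in (ball x 1)ᶜ, ‖f y * (‖x - y‖ : ℂ) ^ (((m / 2 : ℝ) : ℂ) - n)‖ with hD
    have hlim : Tendsto (fun s => invHfunReal n s * D) (nhdsWithin 0 (Ioi 0)) (nhds 0) := by
      simpa using hzero.mul_const D
    refine squeeze_zero_norm' ?_ hlim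
    filter_upwards [hsmall (m / 2) (by linarith)] with s hs
    rw [norm_mul, Complex.norm_real,
      Real.norm_of_nonneg (invHfunReal_nonneg hs.1 (by linarith [hs.2]))]
    refine mul_le_mul_of_nonneg_left ?_ (invHfunReal_nonneg hs.1 (by linarith [hs.2]))
    refine (norm_integral_le_integral_norm _).trans ?_
    refine setIntegral_mono_on (hI s hs.1 (by linarith [hs.2])).norm.integrableOn
      hm2.norm.integrableOn measurableSet_ball.compl fun y hy => ?_
    have hy1 : 1 ≤ ‖x - y‖ := by
      have := (mem_compl_iff _ _).1 hy
      rwa [mem_ball, dist_comm, dist_eq_norm, not_lt] at this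
    rw [norm_mul, norm_mul, norm_kernel (by simp; linarith [hs.2]) (norm_nonneg _),
      norm_kernel (by simp; linarith) (norm_nonneg _)]
    refine mul_le_mul_of_nonneg_left (Real.rpow_le_rpow_of_exponent_le hy1 ?_) (norm_nonneg _)
    simp
    linarith [hs.2]
  have hsum := hball.add hcompl
  rw [add_zero] at hsum
  refine hsum.congr' ?_
  filter_upwards [hsmall m hm] with s hs
  rw [riesz, inv_Hfun_ofReal, ← integral_add_compl measurableSet_ball (hI s hs.1 hs.2), mul_add]
  refine congrArg (· + _) ?_
  rw [← integral_const_mul]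
  refine setIntegral_congr_fun measurableSet_ball fun y _ => ?_
  rw [kernel_ofReal _ (norm_nonneg _), Complex.real_smul]
  push_cast
  ring


theorem stmt_15 (n k : ℕ) (hk1 : 1 ≤ k) (hkn : k < n) (δ : ℝ) (hδ0 : 0 < δ) (hδ1 : δ < 1)
    (f : EuclideanSpace ℝ (Fin n) → ℂ) (hfc : Continuous f)
    (hdecay : f =O[cocompact (EuclideanSpace ℝ (Fin n))] fun y => ‖y‖ ^ (-((k : ℝ) + δ))) :
    ∀ x : EuclideanSpace ℝ (Fin n),
      (∀ y : EuclideanSpace ℝ (Fin n),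
        Integrable (fun z => f z * (‖y - z‖ : ℂ) ^ ((k : ℂ) - n))) ∧
      ∃ F : ℂ → ℂ,
        DifferentiableOn ℂ F {α : ℂ | -(k : ℝ) < α.re ∧ α.re < δ} ∧
        (∀ α : ℂ, 0 < α.re → α.re < δ → F α = riesz n (riesz n f k) α x) ∧
        Filter.Tendsto (fun s : ℝ => F (s : ℂ))
          (nhdsWithin (-(k : ℝ)) (Set.Ioi (-(k : ℝ)))) (nhds (f x)) := by
  have hmn : (k : ℝ) + δ ≤ n := by
    have : (k : ℝ) + 1 ≤ n := by exact_mod_cast hkn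
    linarith
  have hk0 : (0 : ℝ) < k := by exact_mod_cast hk1
  intro x
  refine ⟨fun y => integrable_mul_kernel hfc hmn hdecay (β := k) (by simpa using hk0)
    (by simpa using hδ0) y, fun α => riesz n f (α + k) x, ?_, ?_, ?_⟩
  · intro α hα
    have h := differentiableAt_riesz hfc hmn hdecay (β := α + k) (by simp; linarith [hα.1])
      (by simp; linarith [hα.2]) x
    exact (DifferentiableAt.comp (g := fun β : ℂ => riesz n f β x) α h
      (by fun_prop : DifferentiableAt ℂ (fun α : ℂ => α + k) α)).differentiableWithinAt
  · intro α h0 h1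
    exact (riesz_riesz hfc hmn hdecay h0 (by simpa using hk0) (by simp; linarith) x).symm
  · have h := tendsto_riesz_zero hfc (by linarith : 0 < (k : ℝ) + δ) hmn hdecay x
    have hshift : Tendsto (fun s : ℝ => s + k) (nhdsWithin (-(k : ℝ)) (Ioi (-(k : ℝ))))
        (nhdsWithin 0 (Ioi 0)) := by
      refine tendsto_nhdsWithin_of_tendsto_nhds_of_eventually_within _ ?_ ?_
      · have : ContinuousAt (fun s : ℝ => s + k) (-(k : ℝ)) := by fun_prop
        simpa [ContinuousAt] using this.tendsto.mono_left nhdsWithin_le_nhds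
      · refine eventually_nhdsWithin_of_forall fun s hs => ?_
        have : -(k : ℝ) < s := hs
        simp only [mem_Ioi]
        linarith
    refine (h.comp hshift).congr fun s => ?_
    simp
end

section
/- Let a > 1, l ∈ ℕ₀, n ∈ ℕ, and let f : ℝⁿ → ℂ be C^l with f(x) = O(|x|^{-a}). Let α ∈ ℂ with Re α = 1 and α ∉ n + 2ℕ₀. Then for every ε with 0 < ε < 1 and every x ∈ ℝⁿ, I^α f is C^l on a neighborhood of x with every l-th order partial derivative Hölder continuous of index ε on that neighborhood. -/
open Complex MeasureTheory Filter Asymptotics Set Metric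

theorem ContDiffAt.hasFDerivAt_iteratedFDeriv {E F : Type*} [NormedAddCommGroup E]
    [NormedSpace ℝ E] [NormedAddCommGroup F] [NormedSpace ℝ F] {g : E → F} {x : E} {N m : ℕ}
    (hg : ContDiffAt ℝ N g x) (hm : m < N) :
    HasFDerivAt (iteratedFDeriv ℝ m g) (iteratedFDeriv ℝ (m + 1) g x).curryLeft x := by
  have h := (hg.differentiableAt_iteratedFDeriv (by exact_mod_cast hm)).hasFDerivAt
  rw [fderiv_iteratedFDeriv] at h
  exact h

/-- Smoothness under the integral sign, as a Taylor series of dominated parametric integrals. -/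
theorem hasFTaylorSeriesUpToOn_integral {E F Y : Type*} [NormedAddCommGroup E]
    [NormedSpace ℝ E] [NormedAddCommGroup F] [NormedSpace ℝ F] [CompleteSpace F]
    [MeasurableSpace Y] {μ : Measure Y} {g : E → Y → F} {V : Set E} {N : ℕ} (hV : IsOpen V)
    (hg : ∀ y, ContDiffOn ℝ N (fun x => g x y) V)
    (hmeas : ∀ j ≤ N, ∀ x ∈ V, AEStronglyMeasurable
      (fun y => iteratedFDeriv ℝ j (fun x => g x y) x) μ)
    (hbound : ∀ j ≤ N, ∃ b : Y → ℝ, Integrable b μ ∧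
      ∀ x ∈ V, ∀ y, ‖iteratedFDeriv ℝ j (fun x => g x y) x‖ ≤ b y) :
    HasFTaylorSeriesUpToOn N (fun x => ∫ y, g x y ∂μ)
      (fun x j => ∫ y, iteratedFDeriv ℝ j (fun x => g x y) x ∂μ) V := by
  have hat : ∀ y, ∀ x ∈ V, ContDiffAt ℝ N (fun x => g x y) x := fun y x hx =>
    (hg y).contDiffAt (hV.mem_nhds hx)
  have hint : ∀ j ≤ N, ∀ x ∈ V, Integrable
      (fun y => iteratedFDeriv ℝ j (fun x => g x y) x) μ := by
    intro j hj x hx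
    obtain ⟨b, hb, hbd⟩ := hbound j hj
    exact hb.mono' (hmeas j hj x hx) (ae_of_all _ (hbd x hx))
  have hderiv : ∀ m < N, ∀ x ∈ V,
      HasFDerivAt (fun x => ∫ y, iteratedFDeriv ℝ m (fun x => g x y) x ∂μ)
        (∫ y, iteratedFDeriv ℝ (m + 1) (fun x => g x y) x ∂μ).curryLeft x := by
    intro m hm x hx
    obtain ⟨b, hb, hbd⟩ := hbound (m + 1) hm
    let L : (ContinuousMultilinearMap ℝ (fun _ : Fin (m + 1) => E) F) ≃ₗᵢ[ℝ]
        (E →L[ℝ] ContinuousMultilinearMap ℝ (fun _ : Fin m => E) F) :=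
      (continuousMultilinearCurryLeftEquiv ℝ (fun _ : Fin (m + 1) => E) F)
    have hL := ContinuousLinearMap.integral_comp_comm (𝕜 := ℝ)
      (Fₗ := E →L[ℝ] ContinuousMultilinearMap ℝ (fun _ : Fin m => E) F) (L.toContinuousLinearEquiv :
      (ContinuousMultilinearMap ℝ (fun _ : Fin (m + 1) => E) F) →L[ℝ]
        (E →L[ℝ] ContinuousMultilinearMap ℝ (fun _ : Fin m => E) F)) (hint (m + 1) hm x hx)
    have key := hasFDerivAt_integral_of_dominated_of_fderiv_le (μ := μ) (𝕜 := ℝ)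
      (F := fun x y => iteratedFDeriv ℝ m (fun x => g x y) x)
      (F' := fun x y => L (iteratedFDeriv ℝ (m + 1) (fun x => g x y) x))
      (bound := b) (hV.mem_nhds hx)
      (by filter_upwards [hV.mem_nhds hx] with z hz using hmeas m hm.le z hz)
      (hint m hm.le x hx)
      (L.continuous.comp_aestronglyMeasurable (hmeas (m + 1) hm x hx))
      (ae_of_all _ fun y z hz => by rw [L.norm_map]; exact hbd z hz y) hb
      (ae_of_all _ fun y z hz => (hat y z hz).hasFDerivAt_iteratedFDeriv hm)
    exact key.congr_fderiv hL
  refine ⟨fun x hx => ?_, fun m hm x hx => ?_, fun m hm => ?_⟩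
  · change (∫ y, iteratedFDeriv ℝ 0 (fun x => g x y) x ∂μ) 0 = _
    rw [ContinuousMultilinearMap.integral_apply (hint 0 (Nat.zero_le _) x hx)]
    simp
  · exact (hderiv m (by exact_mod_cast hm) x hx).hasFDerivWithinAt
  · have hm' : m ≤ N := by exact_mod_cast hm
    obtain ⟨b, hb, hbd⟩ := hbound m hm'
    refine continuousOn_of_dominated (hmeas m hm') (fun x hx => ae_of_all _ (hbd x hx)) hb
      (ae_of_all _ fun y => ?_)
    intro x hx
    exact ((hat y x hx).continuousAt_iteratedFDeriv
      (by exact_mod_cast hm')).continuousWithinAt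

section Kernel

variable {E : Type*} [NormedAddCommGroup E] [InnerProductSpace ℝ E]

theorem contDiffAt_norm_cpow (β : ℂ) {N : WithTop ℕ∞} {z : E} (hz : z ≠ 0) :
    ContDiffAt ℝ N (fun z : E => (‖z‖ : ℂ) ^ β) z := by
  have h : ContDiffAt ℝ N (fun z : E => Complex.exp ((Real.log ‖z‖ : ℂ) * β)) z :=
    ((Complex.ofRealCLM.contDiff.contDiffAt.comp z
      ((contDiffAt_norm ℝ hz).log (norm_ne_zero_iff.2 hz))).mul contDiffAt_const).cexp
  refine h.congr_of_eventuallyEq ?_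
  filter_upwards [isOpen_ne.mem_nhds hz] with w hw
  rw [Complex.cpow_def_of_ne_zero (by exact_mod_cast norm_ne_zero_iff.2 hw),
    Complex.ofReal_log (norm_nonneg _)]

theorem norm_norm_cpow {E : Type*} [NormedAddCommGroup E] (β : ℂ) {z : E} (hz : z ≠ 0) :
    ‖(‖z‖ : ℂ) ^ β‖ = ‖z‖ ^ β.re :=
  Complex.norm_cpow_eq_rpow_re_of_pos (norm_pos_iff.2 hz) _

theorem exists_norm_iteratedFDeriv_norm_cpow_le [FiniteDimensional ℝ E] (β : ℂ) (j : ℕ) :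
    ∃ C, 0 ≤ C ∧ ∀ z : E, z ≠ 0 →
      ‖iteratedFDeriv ℝ j (fun z : E => (‖z‖ : ℂ) ^ β) z‖ ≤ C * ‖z‖ ^ (β.re - j) := by
  set k : E → ℂ := fun z => (‖z‖ : ℂ) ^ β with hk
  have hcont : ContinuousOn (iteratedFDeriv ℝ j k) (sphere 0 1) := fun w hw =>
    ((contDiffAt_norm_cpow (N := j) β (ne_of_mem_sphere hw one_ne_zero)).continuousAt_iteratedFDeriv
      le_rfl).continuousWithinAt
  obtain ⟨C, hC⟩ := (isCompact_sphere (0 : E) 1).exists_bound_of_continuousOn hcont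
  refine ⟨max C 0, le_max_right _ _, fun z hz => ?_⟩
  have ht : 0 < ‖z‖ := norm_pos_iff.2 hz
  set t := ‖z‖ with htdef
  let e : E ≃L[ℝ] E := ContinuousLinearEquiv.smulLeft (Units.mk0 t⁻¹ (inv_ne_zero ht.ne'))
  have he : ∀ u, e u = t⁻¹ • u := fun u => rfl
  have hw : e z ∈ sphere (0 : E) 1 := by
    rw [mem_sphere_zero_iff_norm, he, norm_smul, norm_inv, Real.norm_of_nonneg ht.le, ← htdef,
      inv_mul_cancel₀ ht.ne']
  have hkeq : k = fun u => ((t : ℂ) ^ β) • (k ∘ e) u := by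
    funext u
    simp only [hk, Function.comp, he, norm_smul, norm_inv, Real.norm_of_nonneg ht.le, smul_eq_mul]
    rw [← Complex.mul_cpow_ofReal_nonneg ht.le (by positivity), ← Complex.ofReal_mul,
      mul_inv_cancel_left₀ ht.ne']
  have hsm : ContDiffAt ℝ j (k ∘ e) z :=
    (contDiffAt_norm_cpow β (ne_of_mem_sphere hw one_ne_zero)).comp z e.contDiff.contDiffAt
  have hcomp : iteratedFDeriv ℝ j (k ∘ e) z =
      (iteratedFDeriv ℝ j k (e z)).compContinuousLinearMap fun _ => (e : E →L[ℝ] E) := by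
    simpa [iteratedFDerivWithin_univ] using
      e.iteratedFDerivWithin_comp_right k uniqueDiffOn_univ (mem_univ (e z)) j
  have hen : ‖(e : E →L[ℝ] E)‖ ≤ t⁻¹ :=
    ContinuousLinearMap.opNorm_le_bound _ (by positivity) fun u => by
      rw [ContinuousLinearEquiv.coe_coe, he, norm_smul, norm_inv, Real.norm_of_nonneg ht.le]
  rw [hkeq, iteratedFDeriv_const_smul_apply' hsm, norm_smul, hcomp,
    Complex.norm_cpow_eq_rpow_re_of_pos ht, Real.rpow_sub ht, Real.rpow_natCast]
  calc t ^ β.re * ‖(iteratedFDeriv ℝ j k (e z)).compContinuousLinearMap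
        fun _ => (e : E →L[ℝ] E)‖
      ≤ t ^ β.re * (max C 0 * (t⁻¹) ^ j) := by
        gcongr
        refine (ContinuousMultilinearMap.norm_compContinuousLinearMap_le _ _).trans ?_
        rw [Finset.prod_const, Finset.card_univ, Fintype.card_fin]
        gcongr
        exact (hC _ hw).trans (le_max_left _ _)
    _ = _ := by rw [inv_pow]; ring

/-- Radial estimate: interpolation between the mean value bound and the trivial bound. -/
theorem norm_ofReal_cpow_sub_le {β : ℂ} (hβ : β.re ≤ 0) {ε : ℝ} (h0 : 0 ≤ ε) (h1 : ε ≤ 1)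
    {r s : ℝ} (hr : 0 < r) (hrs : r ≤ s) :
    ‖(s : ℂ) ^ β - (r : ℂ) ^ β‖ ≤ (‖β‖ + 2) * (s - r) ^ ε * r ^ (β.re - ε) := by
  have hs : 0 < s := hr.trans_le hrs
  have hB : ‖(s : ℂ) ^ β - (r : ℂ) ^ β‖ ≤ (‖β‖ + 2) * r ^ β.re := by
    refine (norm_sub_le _ _).trans ?_
    rw [Complex.norm_cpow_eq_rpow_re_of_pos hs, Complex.norm_cpow_eq_rpow_re_of_pos hr]
    have := Real.rpow_le_rpow_of_nonpos hr hrs hβ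
    have h3 : 0 ≤ r ^ β.re := by positivity
    nlinarith [norm_nonneg β]
  have hA : ‖(s : ℂ) ^ β - (r : ℂ) ^ β‖ ≤ (‖β‖ + 2) * (r ^ (β.re - 1) * (s - r)) := by
    have hd : ∀ x ∈ Icc r s, HasDerivWithinAt (fun x : ℝ => (x : ℂ) ^ β)
        (β * (x : ℂ) ^ (β - 1)) (Icc r s) x := by
      intro x hx
      have hx0 : 0 < x := hr.trans_le hx.1
      have := ((hasDerivAt_id (x : ℂ)).cpow_const (c := β) (Or.inl (by simpa using hx0))).comp_ofReal
      simpa using this.hasDerivWithinAt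
    have hb : ∀ x ∈ Icc r s, ‖β * (x : ℂ) ^ (β - 1)‖ ≤ ‖β‖ * r ^ (β.re - 1) := by
      intro x hx
      have hx0 : 0 < x := hr.trans_le hx.1
      rw [norm_mul, Complex.norm_cpow_eq_rpow_re_of_pos hx0]
      gcongr
      simpa using Real.rpow_le_rpow_of_nonpos hr hx.1 (by linarith : β.re - 1 ≤ 0)
    have := (convex_Icc r s).norm_image_sub_le_of_norm_hasDerivWithin_le hd hb
      (left_mem_Icc.2 hrs) (right_mem_Icc.2 hrs)
    refine this.trans ?_
    rw [Real.norm_of_nonneg (by linarith), mul_assoc]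
    have h2 : 0 ≤ r ^ (β.re - 1) * (s - r) := mul_nonneg (by positivity) (by linarith)
    nlinarith
  rw [mul_assoc]
  have hpos : 0 < ‖β‖ + 2 := by positivity
  rw [← div_le_iff₀' hpos] at hA hB ⊢
  set X := ‖(s : ℂ) ^ β - (r : ℂ) ^ β‖ / (‖β‖ + 2)
  have hX : 0 ≤ X := by positivity
  calc X = X ^ ε * X ^ (1 - ε) := by
        rw [← Real.rpow_add' hX (by simp)]; simp
    _ ≤ (r ^ (β.re - 1) * (s - r)) ^ ε * (r ^ β.re) ^ (1 - ε) := by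
        gcongr
    _ = _ := by
        rw [Real.mul_rpow (by positivity) (by linarith), ← Real.rpow_mul hr.le,
          ← Real.rpow_mul hr.le, mul_right_comm, ← Real.rpow_add hr, mul_comm]
        ring_nf

theorem norm_norm_cpow_sub_le {E : Type*} [NormedAddCommGroup E] {β : ℂ} (hβ : β.re ≤ 0)
    {ε : ℝ} (h0 : 0 ≤ ε) (h1 : ε ≤ 1) {u v : E} (hu : u ≠ 0) (hv : v ≠ 0) :
    ‖(‖u‖ : ℂ) ^ β - (‖v‖ : ℂ) ^ β‖ ≤
      (‖β‖ + 2) * ‖u - v‖ ^ ε * (‖u‖ ^ (β.re - ε) + ‖v‖ ^ (β.re - ε)) := by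
  wlog h : ‖v‖ ≤ ‖u‖ generalizing u v
  · rw [norm_sub_rev, norm_sub_rev u, add_comm (‖u‖ ^ _)]
    exact this hv hu (le_of_not_ge h)
  refine (norm_ofReal_cpow_sub_le hβ h0 h1 (norm_pos_iff.2 hv) h).trans ?_
  gcongr
  · exact norm_sub_norm_le _ _
  · exact le_add_of_nonneg_left (by positivity)

theorem locallyIntegrable_norm_cpow [FiniteDimensional ℝ E] [MeasurableSpace E] [BorelSpace E]
    [Nontrivial E] {μ : Measure E} [μ.IsAddHaarMeasure] {β : ℂ}
    (hβ : -(Module.finrank ℝ E : ℝ) < β.re) :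
    LocallyIntegrable (fun z : E => (‖z‖ : ℂ) ^ β) μ := by
  refine locallyIntegrable_of_norm_le_rpow (Module.finrank_pos) (C := 1) (α := -β.re)
    (by linarith) ?_ (by fun_prop : Measurable _).aestronglyMeasurable
  filter_upwards [Measure.ae_ne μ 0] with z hz
  rw [norm_norm_cpow β hz]; simp

theorem locallyIntegrable_norm_rpow [FiniteDimensional ℝ E] [MeasurableSpace E] [BorelSpace E]
    [Nontrivial E] {μ : Measure E} [μ.IsAddHaarMeasure] {s : ℝ}
    (hs : -(Module.finrank ℝ E : ℝ) < s) :
    LocallyIntegrable (fun z : E => ‖z‖ ^ s) μ := by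
  refine locallyIntegrable_of_norm_le_rpow (Module.finrank_pos) (C := 1) (α := -s)
    (by linarith) ?_ (by fun_prop : Measurable _).aestronglyMeasurable
  filter_upwards with z
  rw [Real.norm_of_nonneg (by positivity)]; simp

end Kernel

/-- `g` is `C^l` on `V` with `l`-th derivative Hölder continuous of index `ε` on `V`. -/
def HolderDerivOn {E : Type*} [NormedAddCommGroup E] [NormedSpace ℝ E] (l : ℕ) (ε : ℝ)
    (V : Set E) (g : E → ℂ) : Prop :=
  ContDiffOn ℝ l g V ∧ ∃ M : ℝ, ∀ x₁ ∈ V, ∀ x₂ ∈ V,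
    ‖iteratedFDerivWithin ℝ l g V x₁ - iteratedFDerivWithin ℝ l g V x₂‖ ≤ M * ‖x₁ - x₂‖ ^ ε

namespace HolderDerivOn

variable {E : Type*} [NormedAddCommGroup E] [NormedSpace ℝ E] {l : ℕ} {ε : ℝ}
    {V : Set E} {g h : E → ℂ}

theorem congr (hg : HolderDerivOn l ε V g) (hgh : EqOn h g V) : HolderDerivOn l ε V h := by
  obtain ⟨hc, M, hM⟩ := hg
  refine ⟨hc.congr hgh, M, fun x₁ h₁ x₂ h₂ => ?_⟩
  rw [iteratedFDerivWithin_congr hgh h₁, iteratedFDerivWithin_congr hgh h₂]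
  exact hM x₁ h₁ x₂ h₂

theorem add (hV : IsOpen V) (hg : HolderDerivOn l ε V g) (hh : HolderDerivOn l ε V h) :
    HolderDerivOn l ε V (fun x => g x + h x) := by
  obtain ⟨hc, M, hM⟩ := hg
  obtain ⟨hc', M', hM'⟩ := hh
  refine ⟨hc.add hc', M + M', fun x₁ h₁ x₂ h₂ => ?_⟩
  rw [fun_iteratedFDerivWithin_add_apply (hc _ h₁) (hc' _ h₁) hV.uniqueDiffOn h₁,
    fun_iteratedFDerivWithin_add_apply (hc _ h₂) (hc' _ h₂) hV.uniqueDiffOn h₂,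
    add_sub_add_comm, add_mul]
  exact (norm_add_le _ _).trans (add_le_add (hM x₁ h₁ x₂ h₂) (hM' x₁ h₁ x₂ h₂))

theorem const_mul (hV : IsOpen V) (hg : HolderDerivOn l ε V g) (c : ℂ) :
    HolderDerivOn l ε V (fun x => c * g x) := by
  obtain ⟨hc, M, hM⟩ := hg
  refine ⟨contDiffOn_const.mul hc, ‖c‖ * M, fun x₁ h₁ x₂ h₂ => ?_⟩
  have key : ∀ x ∈ V, iteratedFDerivWithin ℝ l (fun x => c * g x) V x =
      c • iteratedFDerivWithin ℝ l g V x := fun x hx =>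
    iteratedFDerivWithin_const_smul_apply (a := c) (hc x hx) hV.uniqueDiffOn hx
  rw [key x₁ h₁, key x₂ h₂, ← smul_sub, norm_smul, mul_assoc]
  gcongr
  exact hM x₁ h₁ x₂ h₂

end HolderDerivOn

theorem exists_norm_le_one_add_norm_rpow_neg {E : Type*} [NormedAddCommGroup E]
    [ProperSpace E] {a : ℝ} (ha : 0 ≤ a) {f : E → ℂ} (hf : Continuous f)
    (hdecay : f =O[cocompact E] fun y => ‖y‖ ^ (-a)) :
    ∃ C, ∀ y, ‖f y‖ ≤ C * (1 + ‖y‖) ^ (-a) := by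
  obtain ⟨C, hC⟩ := hdecay.bound
  have h1 : ∀ᶠ y in cocompact E, 1 ≤ ‖y‖ := (tendsto_norm_cocompact_atTop).eventually_ge_atTop 1
  obtain ⟨t, ht, hts⟩ := mem_cocompact.1 (hC.and h1)
  obtain ⟨D, hD⟩ := ht.exists_bound_of_continuousOn
    (f := fun y => ‖f y‖ * (1 + ‖y‖) ^ a) (by
      exact (hf.norm.mul ((continuous_const.add continuous_norm).rpow_const
        fun _ => Or.inr ha)).continuousOn)
  refine ⟨max D (C * 2 ^ a), fun y => ?_⟩
  have hpos : 0 < 1 + ‖y‖ := by positivity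
  rw [Real.rpow_neg hpos.le, ← div_eq_mul_inv, le_div_iff₀ (by positivity)]
  by_cases hy : y ∈ t
  · exact (Real.le_norm_self _).trans ((hD y hy).trans (le_max_left _ _))
  · obtain ⟨hCy, hy1⟩ := hts hy
    have hy0 : 0 < ‖y‖ := by linarith
    rw [Real.norm_of_nonneg (by positivity), Real.rpow_neg hy0.le, ← div_eq_mul_inv,
      le_div_iff₀ (by positivity)] at hCy
    refine le_trans ?_ (le_max_right _ _)
    calc ‖f y‖ * (1 + ‖y‖) ^ a ≤ ‖f y‖ * (2 * ‖y‖) ^ a := by gcongr; linarith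
      _ = ‖f y‖ * ‖y‖ ^ a * 2 ^ a := by rw [Real.mul_rpow two_pos.le hy0.le]; ring
      _ ≤ _ := by gcongr

section Potential

variable {E : Type*} [NormedAddCommGroup E] [InnerProductSpace ℝ E] [FiniteDimensional ℝ E]
  [MeasurableSpace E] [BorelSpace E] {μ : Measure E} [μ.IsAddHaarMeasure]

/-- Domination of the derivatives of the potential of a density supported away from `x₀`. -/
theorem exists_integrable_bound_iteratedFDeriv {β : ℂ} (hβ : β.re ≤ 0) {a : ℝ}
    (ha : β.re - a < -(Module.finrank ℝ E : ℝ)) {h : E → ℂ} {C : ℝ}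
    (hC : ∀ y, ‖h y‖ ≤ C * (1 + ‖y‖) ^ (-a)) {x₀ : E} (hx₀ : ∀ y ∈ ball x₀ 2, h y = 0) (j : ℕ) :
    ∃ b : E → ℝ, Integrable b μ ∧ ∀ x ∈ ball x₀ 1, ∀ y,
      ‖h y • iteratedFDeriv ℝ j (fun z : E => (‖z‖ : ℂ) ^ β) (x - y)‖ ≤ b y := by
  obtain ⟨D, hD0, hD⟩ := exists_norm_iteratedFDeriv_norm_cpow_le (E := E) β j
  have hC0 : 0 ≤ C := by
    have := (norm_nonneg _).trans (hC 0)
    simpa using this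
  refine ⟨fun y => C * D * (‖x₀‖ + 3) ^ (-β.re) * (1 + ‖y‖) ^ (-(a - β.re)),
    (integrable_one_add_norm (by linarith)).const_mul _, fun x hx y => ?_⟩
  by_cases hy : h y = 0
  · rw [hy, zero_smul, norm_zero]
    positivity
  have h2 : ‖x - x₀‖ < 1 := mem_ball_iff_norm.1 hx
  have h3 : 2 ≤ ‖y - x₀‖ := by
    by_contra! hlt
    exact hy (hx₀ y (mem_ball_iff_norm.2 hlt))
  have h4 : 1 ≤ ‖x - y‖ := by
    have := norm_sub_le (x - x₀) (x - y)
    rw [sub_sub_sub_cancel_left] at this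
    linarith
  have h5 : 1 + ‖y‖ ≤ (‖x₀‖ + 3) * ‖x - y‖ := by
    have e1 : ‖x‖ ≤ ‖x₀‖ + ‖x - x₀‖ := by simpa using norm_add_le x₀ (x - x₀)
    have e2 : ‖y‖ ≤ ‖x‖ + ‖x - y‖ := by simpa using norm_sub_le x (x - y)
    nlinarith [norm_nonneg x₀]
  have h6 : ‖x - y‖ ^ (β.re - j) ≤ (‖x₀‖ + 3) ^ (-β.re) * (1 + ‖y‖) ^ β.re := by
    calc ‖x - y‖ ^ (β.re - j) ≤ ‖x - y‖ ^ β.re :=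
          Real.rpow_le_rpow_of_exponent_le h4 (by simp)
      _ = (‖x₀‖ + 3) ^ (-β.re) * ((‖x₀‖ + 3) * ‖x - y‖) ^ β.re := by
          rw [Real.mul_rpow (by positivity) (norm_nonneg _), ← mul_assoc,
            ← Real.rpow_add (by positivity)]
          simp
      _ ≤ _ := by
          gcongr ?_ * ?_
          exact Real.rpow_le_rpow_of_nonpos (by positivity) h5 hβ
  rw [norm_smul]
  calc _ ≤ (C * (1 + ‖y‖) ^ (-a)) * (D * ((‖x₀‖ + 3) ^ (-β.re) * (1 + ‖y‖) ^ β.re)) := by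
        gcongr
        · exact hC y
        · exact (hD _ (norm_pos_iff.1 (by linarith))).trans (by gcongr)
    _ = _ := by
        have hy1 : 0 < 1 + ‖y‖ := by positivity
        simp only [neg_sub, sub_eq_add_neg β.re, Real.rpow_add hy1]
        ring

theorem integrable_mul_norm_cpow_of_eq_zero_on_ball {β : ℂ} (hβ : β.re ≤ 0) {a : ℝ}
    (ha : β.re - a < -(Module.finrank ℝ E : ℝ)) {h : E → ℂ} (hh : Continuous h) {C : ℝ}
    (hC : ∀ y, ‖h y‖ ≤ C * (1 + ‖y‖) ^ (-a)) {x₀ : E} (hx₀ : ∀ y ∈ ball x₀ 2, h y = 0)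
    {x : E} (hx : x ∈ ball x₀ 1) :
    Integrable (fun y => h y * (‖x - y‖ : ℂ) ^ β) μ := by
  obtain ⟨b, hb, hbd⟩ := exists_integrable_bound_iteratedFDeriv (μ := μ) hβ ha hC hx₀ 0
  refine hb.mono' (hh.measurable.mul (by fun_prop)).aestronglyMeasurable
    (ae_of_all _ fun y => ?_)
  simpa [norm_smul] using hbd x hx y

variable [Nontrivial E]

theorem integrable_norm_cpow_smul_comp_sub {F : Type*} [NormedAddCommGroup F] [NormedSpace ℝ F]
    [NormedSpace ℂ F] {β : ℂ} (hβ : -(Module.finrank ℝ E : ℝ) < β.re) {H : E → F}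
    (hH : Continuous H) (hc : HasCompactSupport H) (x : E) :
    Integrable (fun z : E => ((‖z‖ : ℂ) ^ β) • H (x - z)) μ :=
  (locallyIntegrable_norm_cpow hβ).integrable_smul_right_of_hasCompactSupport
    (hH.comp (continuous_const.sub continuous_id)) (hc.comp_homeomorph (Homeomorph.subLeft x))

/-- The potential of a compactly supported `C^l` density. -/
theorem holderDerivOn_integral_of_hasCompactSupport {β : ℂ} (hβ : β.re ≤ 0) {ε : ℝ}
    (h0 : 0 ≤ ε) (h1 : ε ≤ 1) (hβε : -(Module.finrank ℝ E : ℝ) < β.re - ε) {l : ℕ} {h : E → ℂ}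
    (hh : ContDiff ℝ l h) (hc : HasCompactSupport h) (x₀ : E) :
    HolderDerivOn l ε (ball x₀ 1) (fun x => ∫ y, h y * (‖x - y‖ : ℂ) ^ β ∂μ) := by
  set k : E → ℂ := fun z => (‖z‖ : ℂ) ^ β with hk
  have hβ' : -(Module.finrank ℝ E : ℝ) < β.re := by linarith
  have hD : ∀ j, ∀ z x, j ≤ l → iteratedFDeriv ℝ j (fun x => k z • h (x - z)) x =
      k z • iteratedFDeriv ℝ j h (x - z) := by
    intro j z x hj
    have hs : ContDiffAt ℝ j (fun x => h (x - z)) x :=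
      ((hh.of_le (by exact_mod_cast hj)).comp (contDiff_id.sub contDiff_const)).contDiffAt
    rw [iteratedFDeriv_const_smul_apply' hs, iteratedFDeriv_comp_sub]
  have hDcont : ∀ j ≤ l, Continuous (iteratedFDeriv ℝ j h) := fun j hj =>
    hh.continuous_iteratedFDeriv (by exact_mod_cast hj)
  have hDsupp : ∀ j, HasCompactSupport (iteratedFDeriv ℝ j h) := fun j => hc.iteratedFDeriv j
  obtain ⟨R, hR⟩ := hc.isBounded.subset_closedBall 0
  have hDzero : ∀ j y, R < ‖y‖ → iteratedFDeriv ℝ j h y = 0 := by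
    intro j y hy
    by_contra hne
    have := hR (support_iteratedFDeriv_subset j hne)
    rw [mem_closedBall_zero_iff] at this
    linarith
  have hDle : ∀ j ≤ l, ∃ C, 0 ≤ C ∧ ∀ y, ‖iteratedFDeriv ℝ j h y‖ ≤ C := by
    intro j hj
    obtain ⟨C, hC⟩ := (hDsupp j).exists_bound_of_continuous (hDcont j hj)
    exact ⟨C, (norm_nonneg _).trans (hC 0), hC⟩
  set S : Set E := closedBall 0 (R + ‖x₀‖ + 1) with hS
  have hmem : ∀ x ∈ ball x₀ 1, ∀ y, ‖y‖ ≤ R → x - y ∈ S := by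
    intro x hx y hy
    rw [hS, mem_closedBall_zero_iff]
    have h2 : ‖x - x₀‖ < 1 := mem_ball_iff_norm.1 hx
    have h3 : ‖x‖ ≤ ‖x₀‖ + ‖x - x₀‖ := by
      simpa using norm_add_le x₀ (x - x₀)
    linarith [norm_sub_le x y]
  have htaylor := hasFTaylorSeriesUpToOn_integral (μ := μ) (g := fun x z => k z • h (x - z))
    (N := l) (V := ball x₀ 1) isOpen_ball
    (fun z => ((hh.comp (contDiff_id.sub contDiff_const)).const_smul (k z)).contDiffOn)
    (fun j hj x _ => by
      simp_rw [hD j _ x hj]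
      exact ((locallyIntegrable_norm_cpow hβ').aestronglyMeasurable).smul
        ((hDcont j hj).comp (continuous_const.sub continuous_id)).aestronglyMeasurable)
    (fun j hj => by
      obtain ⟨C, hC0, hC⟩ := hDle j hj
      refine ⟨S.indicator fun z => ‖k z‖ * C, ?_, fun x hx z => ?_⟩
      · refine (integrable_indicator_iff measurableSet_closedBall).2 ?_
        exact (((locallyIntegrable_norm_cpow hβ').integrableOn_isCompact
          (isCompact_closedBall _ _)).norm.mul_const C)
      · rw [hD j z x hj, norm_smul]
        by_cases hz : z ∈ S
        · rw [indicator_of_mem hz]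
          gcongr
          exact hC _
        · rw [indicator_of_notMem hz, hDzero j (x - z), norm_zero, mul_zero]
          by_contra! hle
          exact hz (by simpa using hmem x hx _ hle))
  have hfun : (fun x => ∫ y, h y * (‖x - y‖ : ℂ) ^ β ∂μ) = fun x => ∫ z, k z • h (x - z) ∂μ := by
    funext x
    rw [← integral_sub_left_eq_self _ μ x]
    simp [hk, mul_comm]
  have hder : ∀ x ∈ ball x₀ 1,
      iteratedFDerivWithin ℝ l (fun x => ∫ z, k z • h (x - z) ∂μ) (ball x₀ 1) x =
        ∫ y, k (x - y) • iteratedFDeriv ℝ l h y ∂μ := by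
    intro x hx
    rw [← htaylor.eq_iteratedFDerivWithin_of_uniqueDiffOn le_rfl isOpen_ball.uniqueDiffOn hx,
      ← integral_sub_left_eq_self _ μ x]
    simp_rw [hD l _ x le_rfl, sub_sub_cancel]
  have hint : ∀ x, Integrable (fun y => k (x - y) • iteratedFDeriv ℝ l h y) μ := by
    intro x
    simpa using (integrable_norm_cpow_smul_comp_sub (μ := μ) hβ' (hDcont l le_rfl) (hDsupp l)
      x).comp_sub_left x
  obtain ⟨C, hC0, hC⟩ := hDle l le_rfl
  set ω : E → ℝ := S.indicator fun z => ‖z‖ ^ (β.re - ε) with hω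
  have hω0 : ∀ z, 0 ≤ ω z := fun z => indicator_nonneg (fun z _ => by positivity) z
  have hωint : Integrable ω μ :=
    (integrable_indicator_iff measurableSet_closedBall).2
      ((locallyIntegrable_norm_rpow hβε).integrableOn_isCompact (isCompact_closedBall _ _))
  rw [hfun]
  refine ⟨htaylor.contDiffOn, (‖β‖ + 2) * C * (2 * ∫ z, ω z ∂μ), fun x₁ hx₁ x₂ hx₂ => ?_⟩
  rw [hder x₁ hx₁, hder x₂ hx₂, ← integral_sub (hint x₁) (hint x₂)]
  have hω_eq : ∀ x, ∫ y, ω (x - y) ∂μ = ∫ z, ω z ∂μ := fun x => integral_sub_left_eq_self ω μ x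
  calc _ ≤ ∫ y, ((‖β‖ + 2) * ‖x₁ - x₂‖ ^ ε * C) * (ω (x₁ - y) + ω (x₂ - y)) ∂μ := by
        refine norm_integral_le_of_norm_le
          (((hωint.comp_sub_left x₁).add (hωint.comp_sub_left x₂)).const_mul _) ?_
        filter_upwards [Measure.ae_ne μ x₁, Measure.ae_ne μ x₂] with y hy₁ hy₂
        rw [← sub_smul, norm_smul]
        by_cases hy : ‖y‖ ≤ R
        · have hkk := norm_norm_cpow_sub_le hβ h0 h1 (sub_ne_zero.2 hy₁.symm)
            (sub_ne_zero.2 hy₂.symm)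
          rw [sub_sub_sub_cancel_right] at hkk
          simp only [hω, indicator_of_mem (hmem x₁ hx₁ y hy),
            indicator_of_mem (hmem x₂ hx₂ y hy)]
          refine (mul_le_mul hkk (hC y) (norm_nonneg _) (by positivity)).trans_eq ?_
          ring
        · rw [hDzero l y (not_le.1 hy), norm_zero, mul_zero]
          have := hω0 (x₁ - y)
          have := hω0 (x₂ - y)
          positivity
    _ = _ := by
        rw [integral_const_mul, integral_add (hωint.comp_sub_left x₁) (hωint.comp_sub_left x₂),
          hω_eq, hω_eq]
        ring

/-- The potential of a density supported away from `x₀`, near `x₀`. -/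
theorem holderDerivOn_integral_of_eq_zero_on_ball {β : ℂ} (hβ : β.re ≤ 0) {a : ℝ}
    (ha : β.re - a < -(Module.finrank ℝ E : ℝ)) {ε : ℝ} (h1 : ε ≤ 1) (l : ℕ)
    {h : E → ℂ} (hh : Continuous h) {C : ℝ}
    (hC : ∀ y, ‖h y‖ ≤ C * (1 + ‖y‖) ^ (-a)) {x₀ : E} (hx₀ : ∀ y ∈ ball x₀ 2, h y = 0) :
    HolderDerivOn l ε (ball x₀ 1) (fun x => ∫ y, h y * (‖x - y‖ : ℂ) ^ β ∂μ) := by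
  set k : E → ℂ := fun z => (‖z‖ : ℂ) ^ β with hk
  have hne : ∀ x ∈ ball x₀ 1, ∀ y, h y ≠ 0 → x - y ≠ 0 := by
    rintro x hx y hy hxy
    rw [sub_eq_zero] at hxy
    exact hy (hx₀ y (hxy ▸ ball_subset_ball one_le_two hx))
  have hsm : ∀ (N : ℕ), ∀ x ∈ ball x₀ 1, ∀ y, h y ≠ 0 → ContDiffAt ℝ N (fun x => k (x - y)) x :=
    fun N x hx y hy => (contDiffAt_norm_cpow β (hne x hx y hy)).comp x
      (contDiff_id.sub contDiff_const).contDiffAt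
  have hD : ∀ j, ∀ x ∈ ball x₀ 1, ∀ y, iteratedFDeriv ℝ j (fun x => h y * k (x - y)) x =
      h y • iteratedFDeriv ℝ j k (x - y) := by
    intro j x hx y
    by_cases hy : h y = 0
    · simp only [hy, zero_mul, zero_smul]
      exact congrFun iteratedFDeriv_fun_zero x
    · rw [← iteratedFDeriv_comp_sub]
      exact iteratedFDeriv_const_smul_apply' (a := h y) (hsm j x hx y hy)
  have htaylor := hasFTaylorSeriesUpToOn_integral (μ := μ) (g := fun x y => h y * k (x - y))
    (N := l + 1) (V := ball x₀ 1) isOpen_ball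
    (fun y x hx => by
      by_cases hy : h y = 0
      · simp only [hy, zero_mul]
        exact contDiffWithinAt_const
      · exact (contDiffAt_const.mul (hsm (l + 1) x hx y hy)).contDiffWithinAt)
    (fun j hj x hx => by
      simp_rw [hD j x hx]
      refine hh.aestronglyMeasurable.smul ?_
      have hcont : ContinuousOn (fun y => iteratedFDeriv ℝ j k (x - y)) {x}ᶜ := by
        intro y hy
        have h3 : x - y ≠ 0 := sub_ne_zero.2 (fun h => hy h.symm)
        exact (ContinuousAt.comp (f := fun y => x - y)
          ((contDiffAt_norm_cpow (N := j) β h3).continuousAt_iteratedFDeriv le_rfl)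
          (continuous_const.sub continuous_id).continuousAt).continuousWithinAt
      have := hcont.aestronglyMeasurable (μ := μ) (measurableSet_singleton x).compl
      rwa [restrict_compl_singleton] at this)
    (fun j hj => by
      obtain ⟨b, hb, hbd⟩ := exists_integrable_bound_iteratedFDeriv (μ := μ) hβ ha hC hx₀ j
      exact ⟨b, hb, fun x hx y => by rw [hD j x hx y]; exact hbd x hx y⟩)
  obtain ⟨b, hb, hbd⟩ := exists_integrable_bound_iteratedFDeriv (μ := μ) hβ ha hC hx₀ (l + 1)
  have hLip := fun x₁ (hx₁ : x₁ ∈ ball x₀ 1) x₂ (hx₂ : x₂ ∈ ball x₀ 1) =>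
    (convex_ball x₀ 1).norm_image_sub_le_of_norm_hasFDerivWithin_le (𝕜 := ℝ)
    (C := ∫ y, b y ∂μ) (fun x hx => htaylor.fderivWithin l (by exact_mod_cast l.lt_succ_self) x hx)
    (fun x hx => by
      rw [ContinuousMultilinearMap.curryLeft_norm]
      refine norm_integral_le_of_norm_le hb (ae_of_all _ fun y => ?_)
      rw [hD (l + 1) x hx y]
      exact hbd x hx y) hx₂ hx₁
  have hb0 : 0 ≤ ∫ y, b y ∂μ := integral_nonneg fun y =>
    (norm_nonneg _).trans (hbd x₀ (mem_ball_self one_pos) y)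
  have hlel : (l : WithTop ℕ∞) ≤ ((l + 1 : ℕ) : WithTop ℕ∞) := by exact_mod_cast l.le_succ
  refine ⟨htaylor.contDiffOn.of_le hlel, (∫ y, b y ∂μ) * 2 ^ (1 - ε), fun x₁ hx₁ x₂ hx₂ => ?_⟩
  rw [← htaylor.eq_iteratedFDerivWithin_of_uniqueDiffOn hlel isOpen_ball.uniqueDiffOn hx₁,
    ← htaylor.eq_iteratedFDerivWithin_of_uniqueDiffOn hlel isOpen_ball.uniqueDiffOn hx₂]
  refine (hLip x₁ hx₁ x₂ hx₂).trans ?_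
  rw [mul_assoc]
  gcongr
  have hd : ‖x₁ - x₂‖ ≤ 2 := by
    have e1 : ‖x₁ - x₀‖ < 1 := mem_ball_iff_norm.1 hx₁
    have e2 : ‖x₂ - x₀‖ < 1 := mem_ball_iff_norm.1 hx₂
    have := norm_sub_le (x₁ - x₀) (x₂ - x₀)
    rw [sub_sub_sub_cancel_right] at this
    linarith
  calc ‖x₁ - x₂‖ = ‖x₁ - x₂‖ ^ (1 - ε) * ‖x₁ - x₂‖ ^ ε := by
        rw [← Real.rpow_add' (norm_nonneg _) (by simp)]; simp
    _ ≤ _ := by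
        gcongr

theorem holderDerivOn_integral_norm_cpow {β : ℂ} (hβ : β.re ≤ 0) {a : ℝ} (ha0 : 0 ≤ a)
    (ha : β.re - a < -(Module.finrank ℝ E : ℝ)) {ε : ℝ} (h0 : 0 ≤ ε) (h1 : ε ≤ 1)
    (hβε : -(Module.finrank ℝ E : ℝ) < β.re - ε) {l : ℕ} {f : E → ℂ} (hf : ContDiff ℝ l f)
    (hdecay : f =O[cocompact E] fun y => ‖y‖ ^ (-a)) (x₀ : E) :
    HolderDerivOn l ε (ball x₀ 1) (fun x => ∫ y, f y * (‖x - y‖ : ℂ) ^ β ∂μ) := by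
  let φ : ContDiffBump x₀ := ⟨2, 3, by norm_num, by norm_num⟩
  have hφ : ContDiff ℝ l fun y => ((φ y : ℝ) : ℂ) := Complex.ofRealCLM.contDiff.comp φ.contDiff
  set f₁ : E → ℂ := fun y => (φ y : ℂ) * f y with hf₁
  set f₂ : E → ℂ := fun y => (1 - (φ y : ℂ)) * f y with hf₂
  have hs₁ : ContDiff ℝ l f₁ := hφ.mul hf
  have hs₂ : ContDiff ℝ l f₂ := (contDiff_const.sub hφ).mul hf
  have hc₁ : HasCompactSupport f₁ :=
    (φ.hasCompactSupport.comp_left (g := fun r : ℝ => (r : ℂ)) Complex.ofReal_zero).mul_right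
  have hz₂ : ∀ y ∈ ball x₀ 2, f₂ y = 0 := fun y hy => by
    simp [hf₂, φ.one_of_mem_closedBall (ball_subset_closedBall hy)]
  obtain ⟨C, hC⟩ := exists_norm_le_one_add_norm_rpow_neg ha0 hf.continuous hdecay
  have hC₂ : ∀ y, ‖f₂ y‖ ≤ C * (1 + ‖y‖) ^ (-a) := fun y => by
    refine le_trans ?_ (hC y)
    rw [hf₂, norm_mul, ← Complex.ofReal_one, ← Complex.ofReal_sub, Complex.norm_real,
      Real.norm_of_nonneg (by linarith [φ.le_one (x := y)])]
    exact mul_le_of_le_one_left (norm_nonneg _) (by linarith [φ.nonneg (x := y)])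
  have hβ' : -(Module.finrank ℝ E : ℝ) < β.re := by linarith
  refine ((holderDerivOn_integral_of_hasCompactSupport (μ := μ) hβ h0 h1 hβε hs₁ hc₁ x₀).add
    isOpen_ball (holderDerivOn_integral_of_eq_zero_on_ball (μ := μ) hβ ha h1 l hs₂.continuous hC₂
      hz₂)).congr fun x hx => ?_
  have hi₁ : Integrable (fun y => f₁ y * (‖x - y‖ : ℂ) ^ β) μ := by
    simpa [mul_comm] using
      (integrable_norm_cpow_smul_comp_sub (μ := μ) hβ' hs₁.continuous hc₁ x).comp_sub_left x
  have hi₂ := integrable_mul_norm_cpow_of_eq_zero_on_ball (μ := μ) hβ ha hs₂.continuous hC₂ hz₂ hx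
  change _ = (∫ y, f₁ y * (‖x - y‖ : ℂ) ^ β ∂μ) + ∫ y, f₂ y * (‖x - y‖ : ℂ) ^ β ∂μ
  rw [← integral_add hi₁ hi₂]
  refine integral_congr_ae (ae_of_all _ fun y => ?_)
  simp only [hf₁, hf₂]
  ring

end Potential

theorem stmt_16 (a : ℝ) (ha : 1 < a) (l : ℕ) (n : ℕ) (hn : 0 < n)
    (f : EuclideanSpace ℝ (Fin n) → ℂ) (hf : ContDiff ℝ l f)
    (hdecay : f =O[cocompact (EuclideanSpace ℝ (Fin n))] fun y => ‖y‖ ^ (-a))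
    (α : ℂ) (hα : α.re = 1) (hαpole : ∀ m : ℕ, α ≠ (n : ℂ) + 2 * m) :
    ∀ ε : ℝ, 0 < ε → ε < 1 →
      ∀ x : EuclideanSpace ℝ (Fin n),
        ∃ V : Set (EuclideanSpace ℝ (Fin n)), IsOpen V ∧ x ∈ V ∧
          ContDiffOn ℝ l (riesz n f α) V ∧
          ∃ M : ℝ, ∀ x₁ ∈ V, ∀ x₂ ∈ V,
            ‖iteratedFDerivWithin ℝ l (riesz n f α) V x₁ -
              iteratedFDerivWithin ℝ l (riesz n f α) V x₂‖ ≤ M * ‖x₁ - x₂‖ ^ ε := by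
  intro ε h0 h1 x
  have : Nonempty (Fin n) := ⟨⟨0, hn⟩⟩
  have hfin : Module.finrank ℝ (EuclideanSpace ℝ (Fin n)) = n := finrank_euclideanSpace_fin
  have hn1 : (1 : ℝ) ≤ n := by exact_mod_cast hn
  have hre : (α - n).re = 1 - n := by simp [hα]
  exact ⟨ball x 1, isOpen_ball, mem_ball_self one_pos,
    (holderDerivOn_integral_norm_cpow (by linarith) (by linarith)
      (by rw [hfin]; linarith) h0.le h1.le (by rw [hfin]; linarith) hf hdecay x).const_mul
      isOpen_ball _⟩
end

section
/- Let n ∈ ℕ, ε > 0, and let φ : ℝⁿ → ℂ be C² such that φ and all of its first and second order partial derivatives are O(|x|^{-2-ε}) as |x| → ∞. Then for every α ∈ ℂ with 2 < Re α < 2 + ε and α ∉ n + 2ℕ₀ and α - 2 ∉ n + 2ℕ₀, and every x ∈ ℝⁿ, both integrals below converge absolutely and I^α(Δφ)(x) = -(I^{α-2}φ)(x), i.e. (1/H_n(α)) ∫_{ℝⁿ} (Δφ)(y)|x - y|^{α-n} dy = -(1/H_n(α-2)) ∫_{ℝⁿ} φ(y)|x - y|^{α-2-n} dy, where Δ is the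 Laplacian on ℝⁿ. -/
open Complex MeasureTheory Filter Asymptotics Set Metric

/-- The Laplacian `Δφ = ∑ i ∂²φ/∂xᵢ²` on `ℝⁿ`. -/
noncomputable def lap (n : ℕ) (φ : EuclideanSpace ℝ (Fin n) → ℂ)
    (x : EuclideanSpace ℝ (Fin n)) : ℂ :=
  ∑ i : Fin n,
    fderiv ℝ (fun y => fderiv ℝ φ y (EuclideanSpace.single i 1)) x (EuclideanSpace.single i 1)

open scoped Topology

section NormPower

variable {E : Type*} [NormedAddCommGroup E]

lemma norm_ofReal_norm_cpow {y : E} (hy : y ≠ 0) (β : ℂ) :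
    ‖(‖y‖ : ℂ) ^ β‖ = ‖y‖ ^ β.re :=
  norm_cpow_eq_rpow_re_of_pos (norm_pos_iff.2 hy) β

lemma norm_sq_add_rpow_le {y : E} (hy : y ≠ 0) {δ : ℝ} (hδ : 0 ≤ δ) (hδ1 : δ ≤ 1) (τ : ℝ) :
    (‖y‖ ^ 2 + δ) ^ τ ≤ ‖y‖ ^ (2 * τ) + (‖y‖ ^ 2 + 1) ^ τ := by
  have hy' := norm_pos_iff.2 hy
  rcases le_total 0 τ with h | h
  · have : (‖y‖ ^ 2 + δ) ^ τ ≤ (‖y‖ ^ 2 + 1) ^ τ := by gcongr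
    have : 0 ≤ ‖y‖ ^ (2 * τ) := by positivity
    linarith
  · have h1 : (‖y‖ ^ 2 + δ) ^ τ ≤ (‖y‖ ^ 2) ^ τ :=
      Real.rpow_le_rpow_of_nonpos (by positivity) (by linarith) h
    have h2 : (‖y‖ ^ 2) ^ τ = ‖y‖ ^ (2 * τ) := by
      rw [← Real.rpow_natCast, ← Real.rpow_mul (norm_nonneg _)]; norm_num
    have : 0 ≤ (‖y‖ ^ 2 + 1) ^ τ := by positivity
    linarith

end NormPower

section PowerWeights

variable {E : Type*} [NormedAddCommGroup E] [NormedSpace ℝ E] [FiniteDimensional ℝ E]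

lemma isTheta_norm_add_cocompact (x : E) :
    (fun y : E => ‖x + y‖) =Θ[cocompact E] fun y => ‖y‖ := by
  have h : (fun _ : E => x) =o[cocompact E] fun y => y := by
    rw [isLittleO_const_left]
    right
    exact tendsto_norm_cocompact_atTop
  exact (h.add_isTheta (isTheta_refl (fun y : E => y) (cocompact E))).norm_left.norm_right

lemma Asymptotics.IsBigO.comp_const_add_rpow {F : Type*} [NormedAddCommGroup F] {f : E → F} {b : ℝ}
    (hf : f =O[cocompact E] fun y => ‖y‖ ^ b) (x : E) :
    (fun y => f (x + y)) =O[cocompact E] fun y => ‖y‖ ^ b := by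
  have ht : Tendsto (fun y : E => x + y) (cocompact E) (cocompact E) :=
    (Homeomorph.addLeft x).isClosedEmbedding.tendsto_cocompact
  have hθ := (isTheta_norm_add_cocompact x).rpow (r := b)
    (Eventually.of_forall fun y => norm_nonneg _) (Eventually.of_forall fun y => norm_nonneg _)
  exact (hf.comp_tendsto ht).trans hθ.1

lemma isTheta_norm_sq_add_rpow_cocompact (δ : ℝ) (hδ : 0 ≤ δ) (τ : ℝ) :
    (fun y : E => (‖y‖ ^ 2 + δ) ^ τ) =Θ[cocompact E] fun y => ‖y‖ ^ (2 * τ) := by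
  have hn : Tendsto (fun y : E => ‖y‖ ^ 2) (cocompact E) atTop :=
    (tendsto_pow_atTop two_ne_zero).comp (tendsto_norm_cocompact_atTop (E := E))
  have h : (fun _ : E => δ) =o[cocompact E] fun y => ‖y‖ ^ 2 := by
    rw [isLittleO_const_left]
    right
    exact tendsto_norm_atTop_atTop.comp hn
  have hθ : (fun y : E => ‖y‖ ^ 2 + δ) =Θ[cocompact E] fun y => ‖y‖ ^ 2 :=
    (isTheta_refl (fun y : E => ‖y‖ ^ 2) (cocompact E)).add_isLittleO h
  have := hθ.rpow (r := τ) (Eventually.of_forall fun y => by positivity)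
    (Eventually.of_forall fun y => by positivity)
  refine this.trans_eventuallyEq (Eventually.of_forall fun y => ?_)
  simp only
  rw [← Real.rpow_natCast, ← Real.rpow_mul (norm_nonneg _)]
  norm_num

variable [MeasurableSpace E] [BorelSpace E] {μ : Measure E} [μ.IsAddHaarMeasure]

lemma integrableAtFilter_norm_rpow_cocompact {a : ℝ} (ha : a < -(Module.finrank ℝ E : ℝ)) :
    IntegrableAtFilter (fun y : E => ‖y‖ ^ a) (cocompact E) μ := by
  have hi := integrable_rpow_neg_one_add_norm_sq (μ := μ) (r := -a) (E := E) (by linarith)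
  have hO := (isTheta_norm_sq_add_rpow_cocompact (E := E) 1 zero_le_one (a / 2)).2
  rw [mul_div_cancel₀ a two_ne_zero] at hO
  refine hO.integrableAtFilter ?_ ?_
  · have : Measurable fun y : E => ‖y‖ ^ a := by fun_prop
    exact this.stronglyMeasurable.stronglyMeasurableAtFilter
  · refine Integrable.integrableAtFilter ?_ _
    simpa [add_comm] using hi

lemma integrable_mul_of_isBigO_rpow {g k : E → ℂ} {a b : ℝ} (hg : Continuous g)
    (hgO : g =O[cocompact E] fun y => ‖y‖ ^ b) (hk : LocallyIntegrable k μ)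
    (hkO : k =O[cocompact E] fun y => ‖y‖ ^ a) (hab : a + b < -(Module.finrank ℝ E : ℝ)) :
    Integrable (fun y => g y * k y) μ := by
  refine (hk.continuous_mul hg).integrable_of_isBigO_cocompact ?_
    (integrableAtFilter_norm_rpow_cocompact hab)
  refine (hgO.mul hkO).trans_eventuallyEq ?_
  have h0 : ∀ᶠ y : E in cocompact E, 0 < ‖y‖ :=
    tendsto_norm_cocompact_atTop.eventually_gt_atTop 0
  filter_upwards [h0] with y hy
  rw [← Real.rpow_add hy, add_comm]

lemma integrable_mul_norm_cpow [Nontrivial E] {g : E → ℂ} {b : ℝ} (hg : Continuous g)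
    (hgO : g =O[cocompact E] fun y => ‖y‖ ^ b) {β : ℂ}
    (hβ : -(Module.finrank ℝ E : ℝ) < β.re) (hβb : β.re + b < -(Module.finrank ℝ E : ℝ)) :
    Integrable (fun y => g y * (‖y‖ : ℂ) ^ β) μ := by
  have hne : ∀ᵐ y ∂μ, y ≠ (0 : E) := by simp [ae_iff]
  refine integrable_mul_of_isBigO_rpow (a := β.re) hg hgO ?_ ?_ hβb
  · refine locallyIntegrable_of_norm_le_rpow (C := 1) (α := -β.re) Module.finrank_pos
      (by linarith) ?_ (by fun_prop : Measurable fun y : E => (‖y‖ : ℂ) ^ β).aestronglyMeasurable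
    filter_upwards [hne] with y hy
    rw [norm_ofReal_norm_cpow hy, neg_neg, one_mul]
  · have h0 : ∀ᶠ y : E in cocompact E, 0 < ‖y‖ :=
      tendsto_norm_cocompact_atTop.eventually_gt_atTop 0
    refine IsBigO.of_bound 1 ?_
    filter_upwards [h0] with y hy
    rw [norm_ofReal_norm_cpow (norm_pos_iff.1 hy), one_mul]
    exact le_abs_self _

lemma tendsto_integral_mul_of_norm_le_rpow [Nontrivial E] {g : E → ℂ} {b τ C : ℝ}
    (hg : Continuous g) (hgO : g =O[cocompact E] fun y => ‖y‖ ^ b)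
    {k : ℝ → E → ℂ} {k₀ : E → ℂ} (hk : ∀ δ, 0 < δ → Continuous (k δ))
    (hbound : ∀ δ, 0 < δ → ∀ y, ‖k δ y‖ ≤ C * (‖y‖ ^ 2 + δ) ^ τ)
    (hlim : ∀ y, y ≠ 0 → Tendsto (fun δ => k δ y) (𝓝[>] 0) (𝓝 (k₀ y)))
    (hτ : -(Module.finrank ℝ E : ℝ) < 2 * τ) (hτb : 2 * τ + b < -(Module.finrank ℝ E : ℝ)) :
    Tendsto (fun δ => ∫ y, g y * k δ y ∂μ) (𝓝[>] 0) (𝓝 (∫ y, g y * k₀ y ∂μ)) := by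
  have hne : ∀ᵐ y ∂μ, y ≠ (0 : E) := by simp [ae_iff]
  have hδ : ∀ᶠ δ : ℝ in 𝓝[>] 0, δ ∈ Ioc (0 : ℝ) 1 := Ioc_mem_nhdsGT zero_lt_one
  have hi₁ : Integrable (fun y => g y * (‖y‖ : ℂ) ^ ((2 * τ : ℝ) : ℂ)) μ :=
    integrable_mul_norm_cpow hg hgO (by simpa using hτ) (by simpa using hτb)
  have hc : Continuous fun y : E => (((‖y‖ ^ 2 + 1) ^ τ : ℝ) : ℂ) :=
    continuous_ofReal.comp (Continuous.rpow_const (by fun_prop) fun y => Or.inl (by positivity))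
  have hi₂ : Integrable (fun y => g y * (((‖y‖ ^ 2 + 1) ^ τ : ℝ) : ℂ)) μ := by
    refine integrable_mul_of_isBigO_rpow (a := 2 * τ) hg hgO hc.locallyIntegrable ?_ hτb
    have := (isTheta_norm_sq_add_rpow_cocompact (E := E) 1 zero_le_one τ).1
    rw [← isBigO_norm_left] at this ⊢
    simpa only [norm_real] using this
  have hC : 0 ≤ C := by
    have := (norm_nonneg _).trans (hbound 1 one_pos 0)
    simpa using this
  refine tendsto_integral_filter_of_dominated_convergence
    (fun y => C * (‖g y * (‖y‖ : ℂ) ^ ((2 * τ : ℝ) : ℂ)‖ +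
      ‖g y * (((‖y‖ ^ 2 + 1) ^ τ : ℝ) : ℂ)‖)) ?_ ?_ ((hi₁.norm.add hi₂.norm).const_mul C) ?_
  · filter_upwards [hδ] with δ hδ
    exact (hg.mul (hk δ hδ.1)).aestronglyMeasurable
  · filter_upwards [hδ] with δ hδ
    filter_upwards [hne] with y hy
    rw [norm_mul, norm_mul, norm_mul, norm_ofReal_norm_cpow hy, norm_real, ofReal_re,
      Real.norm_of_nonneg (by positivity), ← mul_add, mul_left_comm]
    gcongr
    exact (hbound δ hδ.1 y).trans
      (mul_le_mul_of_nonneg_left (norm_sq_add_rpow_le hy hδ.1.le hδ.2 τ) hC)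
  · filter_upwards [hne] with y hy
    exact (hlim y hy).const_mul _

end PowerWeights

section RegularizedKernel

variable {E : Type*} [NormedAddCommGroup E]

/-- The regularization `(‖y‖² + δ)^s` of the kernel `‖y‖^(2s)`. -/
noncomputable def regKernel (s : ℂ) (δ : ℝ) (y : E) : ℂ := ((‖y‖ ^ 2 + δ : ℝ) : ℂ) ^ s

lemma norm_regKernel (s : ℂ) {δ : ℝ} (hδ : 0 < δ) (y : E) :
    ‖regKernel s δ y‖ = (‖y‖ ^ 2 + δ) ^ s.re :=
  norm_cpow_eq_rpow_re_of_pos (by positivity) s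

lemma continuous_regKernel (s : ℂ) {δ : ℝ} (hδ : 0 < δ) :
    Continuous (regKernel (E := E) s δ) :=
  Continuous.cpow (by fun_prop) continuous_const fun y =>
    ofReal_mem_slitPlane.2 (by positivity)

lemma regKernel_isBigO [NormedSpace ℝ E] [FiniteDimensional ℝ E] (s : ℂ) {δ : ℝ} (hδ : 0 < δ) :
    regKernel s δ =O[cocompact E] fun y => ‖y‖ ^ (2 * s.re) := by
  rw [← isBigO_norm_left]
  simpa only [norm_regKernel s hδ] using (isTheta_norm_sq_add_rpow_cocompact δ hδ.le s.re).1

lemma tendsto_regKernel (s : ℂ) {y : E} (hy : y ≠ 0) :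
    Tendsto (fun δ => regKernel s δ y) (𝓝[>] 0) (𝓝 ((‖y‖ : ℂ) ^ (2 * s))) := by
  have h0 : 0 < ‖y‖ ^ 2 := by have := norm_pos_iff.2 hy; positivity
  have hc : ContinuousAt (fun δ : ℝ => regKernel s δ y) 0 := by
    refine ContinuousAt.cpow (by fun_prop) continuousAt_const (ofReal_mem_slitPlane.2 ?_)
    simpa using h0
  have := hc.tendsto.mono_left (nhdsWithin_le_nhds (s := Ioi 0))
  convert this using 2
  have hn : (‖y‖ : ℂ) ≠ 0 := by simpa using hy
  simp only [regKernel, add_zero]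
  rw [mul_comm, cpow_mul_ofNat, ofReal_pow, sq, sq,
    mul_cpow_ofReal_nonneg (norm_nonneg y) (norm_nonneg y)]

end RegularizedKernel

section Euclidean

variable {n : ℕ}

lemma hasLineDerivAt_regKernel (s : ℂ) {δ : ℝ} (hδ : 0 < δ) (y : EuclideanSpace ℝ (Fin n))
    (i : Fin n) :
    HasLineDerivAt ℝ (regKernel s δ) (2 * s * (y i * regKernel (s - 1) δ y)) y
      (EuclideanSpace.single i 1) := by
  have h1 : HasLineDerivAt ℝ (fun z : EuclideanSpace ℝ (Fin n) => ‖z‖ ^ 2 + δ) (2 * y i) y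
      (EuclideanSpace.single i 1) := by
    have := ((hasStrictFDerivAt_norm_sq y).hasFDerivAt.add_const δ).hasLineDerivAt
      (EuclideanSpace.single i (1 : ℝ))
    simpa [EuclideanSpace.inner_single_right] using this
  have hq : ((‖y‖ ^ 2 + δ : ℝ) : ℂ) ∈ slitPlane := ofReal_mem_slitPlane.2 (by positivity)
  have h2 := (hasStrictDerivAt_cpow_const (c := s) hq).hasDerivAt.comp_of_eq (0 : ℝ)
    (HasDerivAt.ofReal_comp h1) (by simp)
  refine HasDerivAt.congr_deriv h2 ?_
  simp only [regKernel]
  push_cast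
  ring

lemma hasLineDerivAt_coord_mul_regKernel (s : ℂ) {δ : ℝ} (hδ : 0 < δ)
    (y : EuclideanSpace ℝ (Fin n)) (i : Fin n) :
    HasLineDerivAt ℝ (fun z => 2 * s * (z i * regKernel (s - 1) δ z))
      (2 * s * regKernel (s - 1) δ y +
        4 * s * (s - 1) * ((y i : ℂ) ^ 2 * regKernel (s - 1 - 1) δ y)) y
      (EuclideanSpace.single i 1) := by
  have h1 : HasLineDerivAt ℝ (fun z : EuclideanSpace ℝ (Fin n) => (z i : ℂ)) 1 y
      (EuclideanSpace.single i 1) := by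
    have h : HasDerivAt (fun t : ℝ => y i + t) 1 0 := by
      simpa using (hasDerivAt_id (0 : ℝ)).const_add (y i)
    simpa [HasLineDerivAt] using h.ofReal_comp
  have h2 := (HasDerivAt.mul h1 (hasLineDerivAt_regKernel (s - 1) hδ y i)).const_mul (2 * s)
  refine HasDerivAt.congr_deriv h2 ?_
  simp
  ring

lemma norm_coord_mul_regKernel_le (s : ℂ) {δ : ℝ} (hδ : 0 < δ) (y : EuclideanSpace ℝ (Fin n))
    (i : Fin n) :
    ‖2 * s * (y i * regKernel (s - 1) δ y)‖ ≤ ‖2 * s‖ * (‖y‖ ^ 2 + δ) ^ (s.re - 1 / 2) := by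
  have hq : 0 < ‖y‖ ^ 2 + δ := by positivity
  have hy : ‖y i‖ ≤ (‖y‖ ^ 2 + δ) ^ (1 / 2 : ℝ) := by
    rw [← Real.sqrt_eq_rpow]
    exact (PiLp.norm_apply_le y i).trans (Real.le_sqrt_of_sq_le (by linarith))
  rw [norm_mul, norm_mul (y i : ℂ), norm_regKernel _ hδ, norm_real]
  gcongr
  calc ‖y i‖ * (‖y‖ ^ 2 + δ) ^ (s - 1).re
      ≤ (‖y‖ ^ 2 + δ) ^ (1 / 2 : ℝ) * (‖y‖ ^ 2 + δ) ^ (s - 1).re := by gcongr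
    _ = (‖y‖ ^ 2 + δ) ^ (s.re - 1 / 2) := by
      rw [← Real.rpow_add hq]
      congr 1
      simp
      ring

lemma isBigO_coord_mul_regKernel (s : ℂ) {δ : ℝ} (hδ : 0 < δ) (i : Fin n) :
    (fun y : EuclideanSpace ℝ (Fin n) => 2 * s * (y i * regKernel (s - 1) δ y))
      =O[cocompact _] fun y => ‖y‖ ^ (2 * (s.re - 1 / 2)) :=
  (IsBigO.of_bound ‖2 * s‖ (Eventually.of_forall fun y => by
    rw [Real.norm_of_nonneg (by positivity)]
    exact norm_coord_mul_regKernel_le s hδ y i)).trans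
    (isTheta_norm_sq_add_rpow_cocompact δ hδ.le _).1

lemma norm_sq_coord_mul_regKernel_le (s : ℂ) {δ : ℝ} (hδ : 0 < δ)
    (y : EuclideanSpace ℝ (Fin n)) (r : ℝ) (hr : |r| ≤ ‖y‖) :
    ‖(r : ℂ) ^ 2 * regKernel (s - 1) δ y‖ ≤ (‖y‖ ^ 2 + δ) ^ s.re := by
  have hq : 0 < ‖y‖ ^ 2 + δ := by positivity
  rw [norm_mul, norm_regKernel _ hδ, norm_pow, norm_real, Real.norm_eq_abs]
  calc |r| ^ 2 * (‖y‖ ^ 2 + δ) ^ (s - 1).re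
      ≤ (‖y‖ ^ 2 + δ) ^ (1 : ℝ) * (‖y‖ ^ 2 + δ) ^ (s - 1).re := by
        rw [Real.rpow_one]
        gcongr
        nlinarith [pow_le_pow_left₀ (abs_nonneg r) hr 2]
    _ = (‖y‖ ^ 2 + δ) ^ s.re := by
      rw [← Real.rpow_add hq]
      simp

lemma norm_combination_regKernel_le (a b s : ℂ) {δ : ℝ} (hδ : 0 < δ)
    (y : EuclideanSpace ℝ (Fin n)) (r : ℝ) (hr : |r| ≤ ‖y‖) :
    ‖a * regKernel s δ y + b * ((r : ℂ) ^ 2 * regKernel (s - 1) δ y)‖ ≤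
      (‖a‖ + ‖b‖) * (‖y‖ ^ 2 + δ) ^ s.re := by
  refine (norm_add_le _ _).trans ?_
  rw [norm_mul, norm_mul b, norm_regKernel s hδ, add_mul]
  gcongr
  exact norm_sq_coord_mul_regKernel_le s hδ y r hr

lemma isBigO_combination_regKernel (a b s : ℂ) {δ : ℝ} (hδ : 0 < δ) (i : Fin n) :
    (fun y : EuclideanSpace ℝ (Fin n) =>
      a * regKernel s δ y + b * ((y i : ℂ) ^ 2 * regKernel (s - 1) δ y))
      =O[cocompact _] fun y => ‖y‖ ^ (2 * s.re) :=
  (IsBigO.of_bound (‖a‖ + ‖b‖) (Eventually.of_forall fun y => by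
    rw [Real.norm_of_nonneg (by positivity)]
    exact norm_combination_regKernel_le a b s hδ y _ (PiLp.norm_apply_le y i))).trans
    (isTheta_norm_sq_add_rpow_cocompact δ hδ.le _).1

variable {φ : EuclideanSpace ℝ (Fin n) → ℂ} {b : ℝ}

lemma ContDiff.continuous_partial (hφ : ContDiff ℝ 2 φ) (v : EuclideanSpace ℝ (Fin n)) :
    Continuous fun y => fderiv ℝ φ y v :=
  (hφ.continuous_fderiv (by norm_num)).clm_apply continuous_const

lemma ContDiff.contDiff_partial (hφ : ContDiff ℝ 2 φ) (v : EuclideanSpace ℝ (Fin n)) :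
    ContDiff ℝ 1 fun y => fderiv ℝ φ y v :=
  (hφ.fderiv_right (m := 1) (by norm_num)).clm_apply contDiff_const

lemma ContDiff.continuous_partial_partial (hφ : ContDiff ℝ 2 φ)
    (v : EuclideanSpace ℝ (Fin n)) :
    Continuous fun x => fderiv ℝ (fun y => fderiv ℝ φ y v) x v :=
  ((hφ.contDiff_partial v).continuous_fderiv one_ne_zero).clm_apply continuous_const

lemma continuous_lap (hφ : ContDiff ℝ 2 φ) : Continuous (lap n φ) :=
  continuous_finsetSum _ fun _ _ => hφ.continuous_partial_partial _

lemma isBigO_lap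
    (h : ∀ i, (fun x => fderiv ℝ (fun y => fderiv ℝ φ y (EuclideanSpace.single i 1)) x
      (EuclideanSpace.single i 1)) =O[cocompact _] fun y => ‖y‖ ^ b) :
    lap n φ =O[cocompact _] fun y => ‖y‖ ^ b :=
  (IsBigO.sum fun i (_ : i ∈ Finset.univ) => h i).congr_left fun y => by
    simp [lap]

/-- Two integrations by parts against the regularized kernel, in one coordinate direction. -/
lemma integral_partial_partial_mul_regKernel (hφ : ContDiff ℝ 2 φ) (i : Fin n)
    (h0 : φ =O[cocompact _] fun y => ‖y‖ ^ b)
    (h1 : (fun y => fderiv ℝ φ y (EuclideanSpace.single i 1)) =O[cocompact _] fun y => ‖y‖ ^ b)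
    (h2 : (fun x => fderiv ℝ (fun y => fderiv ℝ φ y (EuclideanSpace.single i 1)) x
      (EuclideanSpace.single i 1)) =O[cocompact _] fun y => ‖y‖ ^ b)
    (s : ℂ) (hs : 2 * s.re + b < -n) {δ : ℝ} (hδ : 0 < δ) :
    Integrable (fun y => φ y * (2 * s * regKernel (s - 1) δ y +
      4 * s * (s - 1) * ((y i : ℂ) ^ 2 * regKernel (s - 1 - 1) δ y))) ∧
    Integrable (fun x => fderiv ℝ (fun y => fderiv ℝ φ y (EuclideanSpace.single i 1)) x
      (EuclideanSpace.single i 1) * regKernel s δ x) ∧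
    ∫ x, fderiv ℝ (fun y => fderiv ℝ φ y (EuclideanSpace.single i 1)) x
      (EuclideanSpace.single i 1) * regKernel s δ x =
    ∫ y, φ y * (2 * s * regKernel (s - 1) δ y +
      4 * s * (s - 1) * ((y i : ℂ) ^ 2 * regKernel (s - 1 - 1) δ y)) := by
  have hfr : Module.finrank ℝ (EuclideanSpace ℝ (Fin n)) = n := by simp
  have hc0 := continuous_regKernel (E := EuclideanSpace ℝ (Fin n)) s hδ
  have hc1 := continuous_regKernel (E := EuclideanSpace ℝ (Fin n)) (s - 1) hδ
  have hc2 := continuous_regKernel (E := EuclideanSpace ℝ (Fin n)) (s - 1 - 1) hδ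
  have hk1 : Continuous fun y : EuclideanSpace ℝ (Fin n) =>
    2 * s * (y i * regKernel (s - 1) δ y) := by fun_prop
  have hk2 : Continuous fun y : EuclideanSpace ℝ (Fin n) => 2 * s * regKernel (s - 1) δ y +
      4 * s * (s - 1) * ((y i : ℂ) ^ 2 * regKernel (s - 1 - 1) δ y) := by fun_prop
  have i00 {g : EuclideanSpace ℝ (Fin n) → ℂ} (hg : Continuous g)
      (hO : g =O[cocompact _] fun y => ‖y‖ ^ b) : Integrable fun y => g y * regKernel s δ y :=
    integrable_mul_of_isBigO_rpow hg hO hc0.locallyIntegrable (regKernel_isBigO s hδ)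
      (by rw [hfr]; exact hs)
  have i01 {g : EuclideanSpace ℝ (Fin n) → ℂ} (hg : Continuous g)
      (hO : g =O[cocompact _] fun y => ‖y‖ ^ b) :
      Integrable fun y => g y * (2 * s * (y i * regKernel (s - 1) δ y)) :=
    integrable_mul_of_isBigO_rpow hg hO hk1.locallyIntegrable
      (isBigO_coord_mul_regKernel s hδ i) (by rw [hfr]; linarith)
  have i02 : Integrable (fun y => φ y * (2 * s * regKernel (s - 1) δ y +
      4 * s * (s - 1) * ((y i : ℂ) ^ 2 * regKernel (s - 1 - 1) δ y))) :=
    integrable_mul_of_isBigO_rpow hφ.continuous h0 hk2.locallyIntegrable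
      (isBigO_combination_regKernel _ _ (s - 1) hδ i) (by rw [hfr, sub_re, one_re]; linarith)
  have hd0 (x : EuclideanSpace ℝ (Fin n)) :=
    (hφ.differentiable (by norm_num) x).hasFDerivAt.hasLineDerivAt (EuclideanSpace.single i 1)
  have hd1 (x : EuclideanSpace ℝ (Fin n)) :=
    ((hφ.contDiff_partial (EuclideanSpace.single i 1)).differentiable
      one_ne_zero x).hasFDerivAt.hasLineDerivAt (EuclideanSpace.single i 1)
  have p1 := integral_bilinear_hasLineDerivAt_right_eq_neg_left_of_integrable
    (μ := volume) (B := ContinuousLinearMap.mul ℝ ℂ)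
    (i00 (hφ.continuous_partial_partial _) h2) (i01 (hφ.continuous_partial _) h1)
    (i00 (hφ.continuous_partial _) h1) (fun x _ => hd1 x)
    (fun x _ => hasLineDerivAt_regKernel s hδ x i)
  have p2 := integral_bilinear_hasLineDerivAt_right_eq_neg_left_of_integrable
    (μ := volume) (B := ContinuousLinearMap.mul ℝ ℂ)
    (i01 (hφ.continuous_partial _) h1) i02 (i01 hφ.continuous h0) (fun x _ => hd0 x)
    (fun x _ => hasLineDerivAt_coord_mul_regKernel s hδ x i)
  refine ⟨i02, i00 (hφ.continuous_partial_partial _) h2, ?_⟩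
  simp only [ContinuousLinearMap.mul_apply'] at p1 p2
  rw [p2, p1, neg_neg]

lemma integral_lap_mul_regKernel (hφ : ContDiff ℝ 2 φ)
    (h0 : φ =O[cocompact _] fun y => ‖y‖ ^ b)
    (h1 : ∀ i, (fun y => fderiv ℝ φ y (EuclideanSpace.single i 1))
      =O[cocompact _] fun y => ‖y‖ ^ b)
    (h2 : ∀ i, (fun x => fderiv ℝ (fun y => fderiv ℝ φ y (EuclideanSpace.single i 1)) x
      (EuclideanSpace.single i 1)) =O[cocompact _] fun y => ‖y‖ ^ b)
    (s : ℂ) (hs : 2 * s.re + b < -n) {δ : ℝ} (hδ : 0 < δ) :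
    ∫ y, lap n φ y * regKernel s δ y =
    ∫ y, φ y * (2 * s * n * regKernel (s - 1) δ y +
      4 * s * (s - 1) * ((‖y‖ : ℂ) ^ 2 * regKernel (s - 1 - 1) δ y)) := by
  have key i := integral_partial_partial_mul_regKernel hφ i h0 (h1 i) (h2 i) s hs hδ
  simp only [lap, Finset.sum_mul]
  rw [integral_finsetSum _ fun i _ => (key i).2.1,
    Finset.sum_congr rfl fun i _ => (key i).2.2,
    ← integral_finsetSum _ fun i _ => (key i).1]
  congr 1 with y
  have hn : (‖y‖ : ℂ) ^ 2 = ∑ i, (y i : ℂ) ^ 2 := by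
    rw [← ofReal_pow, EuclideanSpace.real_norm_sq_eq]
    push_cast
    rfl
  rw [← Finset.mul_sum, Finset.sum_add_distrib, hn, Finset.sum_mul, Finset.mul_sum]
  simp
  ring_nf
  simp

lemma integral_lap_mul_norm_cpow (hn : 0 < n) (hφ : ContDiff ℝ 2 φ)
    (h0 : φ =O[cocompact _] fun y => ‖y‖ ^ b)
    (h1 : ∀ i, (fun y => fderiv ℝ φ y (EuclideanSpace.single i 1))
      =O[cocompact _] fun y => ‖y‖ ^ b)
    (h2 : ∀ i, (fun x => fderiv ℝ (fun y => fderiv ℝ φ y (EuclideanSpace.single i 1)) x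
      (EuclideanSpace.single i 1)) =O[cocompact _] fun y => ‖y‖ ^ b)
    (α : ℂ) (hα : 2 < α.re) (hαb : α.re + b < 0) :
    ∫ y, lap n φ y * (‖y‖ : ℂ) ^ (α - n) =
      (α - n) * (α - 2) * ∫ y, φ y * (‖y‖ : ℂ) ^ (α - 2 - n) := by
  have : Nonempty (Fin n) := ⟨⟨0, hn⟩⟩
  have : Nontrivial (EuclideanSpace ℝ (Fin n)) := inferInstance
  have hfr : Module.finrank ℝ (EuclideanSpace ℝ (Fin n)) = n := by simp
  have hlap : lap n φ =O[cocompact _] fun y => ‖y‖ ^ b := isBigO_lap h2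
  set s : ℂ := (α - n) / 2 with hs
  have hsre : s.re = (α.re - n) / 2 := by
    rw [hs, show (2 : ℂ) = ((2 : ℝ) : ℂ) by norm_num, div_ofReal_re]
    simp
  have hc (t : ℂ) (δ : ℝ) (hδ : 0 < δ) :=
    continuous_regKernel (E := EuclideanSpace ℝ (Fin n)) t hδ
  have hL := tendsto_integral_mul_of_norm_le_rpow (μ := volume) (C := 1) (τ := s.re)
    (continuous_lap hφ) hlap (hc s)
    (fun δ hδ y => by rw [norm_regKernel s hδ, one_mul]) (fun y hy => tendsto_regKernel s hy)
    (by rw [hfr, hsre]; linarith) (by rw [hfr, hsre]; linarith)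
  have hR := tendsto_integral_mul_of_norm_le_rpow (μ := volume) (τ := (s - 1).re)
    (C := ‖2 * s * n‖ + ‖4 * s * (s - 1)‖)
    (k := fun δ y => 2 * s * n * regKernel (s - 1) δ y +
      4 * s * (s - 1) * ((‖y‖ : ℂ) ^ 2 * regKernel (s - 1 - 1) δ y))
    (k₀ := fun y => (α - n) * (α - 2) * (‖y‖ : ℂ) ^ (α - 2 - n))
    hφ.continuous h0
    (fun δ hδ => by
      have := hc (s - 1) δ hδ
      have := hc (s - 1 - 1) δ hδ
      fun_prop)
    (fun δ hδ y => norm_combination_regKernel_le _ _ _ hδ y _ (abs_norm y).le)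
    (fun y hy => by
      have := ((tendsto_regKernel (s - 1) hy).const_mul (2 * s * n)).add
        (((tendsto_regKernel (s - 1 - 1) hy).const_mul ((‖y‖ : ℂ) ^ 2)).const_mul
          (4 * s * (s - 1)))
      convert this using 2
      have hy' : (‖y‖ : ℂ) ≠ 0 := by simpa using hy
      have e1 : (‖y‖ : ℂ) ^ 2 * (‖y‖ : ℂ) ^ (2 * (s - 1 - 1)) = (‖y‖ : ℂ) ^ (α - 2 - n) := by
        rw [← cpow_ofNat, ← cpow_add _ _ hy', hs]
        congr 1
        ring
      have e2 : 2 * (s - 1) = α - 2 - n := by rw [hs]; ring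
      rw [e1, e2, hs]
      ring)
    (by rw [hfr, sub_re, hsre, one_re]; linarith)
    (by rw [hfr, sub_re, hsre, one_re]; linarith)
  have heq : (fun δ => ∫ y, lap n φ y * regKernel s δ y) =ᶠ[𝓝[>] 0] fun δ =>
      ∫ y, φ y * (2 * s * n * regKernel (s - 1) δ y +
        4 * s * (s - 1) * ((‖y‖ : ℂ) ^ 2 * regKernel (s - 1 - 1) δ y)) := by
    filter_upwards [self_mem_nhdsWithin] with δ hδ
    exact integral_lap_mul_regKernel hφ h0 h1 h2 s (by rw [hsre]; linarith) hδ
  have := tendsto_nhds_unique (hL.congr' heq) hR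
  rw [show 2 * s = α - n by rw [hs]; ring] at this
  rw [this, ← integral_const_mul]
  congr 1 with y
  ring

lemma lap_comp_const_add (φ : EuclideanSpace ℝ (Fin n) → ℂ) (x y : EuclideanSpace ℝ (Fin n)) :
    lap n (fun z => φ (x + z)) y = lap n φ (x + y) := by
  simp only [lap, fderiv_comp_add_left]
  refine Finset.sum_congr rfl fun i _ => ?_
  rw [fderiv_comp_add_left (f := fun z => fderiv ℝ φ z (EuclideanSpace.single i 1))]

lemma isBigO_partial (h : (fun x => iteratedFDeriv ℝ 1 φ x) =O[cocompact _] fun x => ‖x‖ ^ b)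
    (i : Fin n) :
    (fun y => fderiv ℝ φ y (EuclideanSpace.single i 1)) =O[cocompact _] fun y => ‖y‖ ^ b := by
  refine (IsBigO.of_bound 1 (Eventually.of_forall fun y => ?_)).trans h
  rw [norm_iteratedFDeriv_one, one_mul]
  simpa using (fderiv ℝ φ y).le_opNorm (EuclideanSpace.single i 1)

lemma isBigO_partial_partial (hφ : ContDiff ℝ 2 φ)
    (h : (fun x => iteratedFDeriv ℝ 2 φ x) =O[cocompact _] fun x => ‖x‖ ^ b) (i : Fin n) :
    (fun x => fderiv ℝ (fun y => fderiv ℝ φ y (EuclideanSpace.single i 1)) x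
      (EuclideanSpace.single i 1)) =O[cocompact _] fun y => ‖y‖ ^ b := by
  refine (IsBigO.of_bound 1 (Eventually.of_forall fun y => ?_)).trans h
  have hd : DifferentiableAt ℝ (fderiv ℝ φ) y :=
    (hφ.fderiv_right (m := 1) (by norm_num)).differentiable one_ne_zero y
  rw [fderiv_clm_apply hd (differentiableAt_const _), ← norm_iteratedFDeriv_fderiv,
    norm_iteratedFDeriv_one, one_mul]
  simpa using (fderiv ℝ (fderiv ℝ φ) y).le_opNorm₂ (EuclideanSpace.single i 1)
    (EuclideanSpace.single i 1)

end Euclidean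

lemma Hfun_inv_mul {n : ℕ} {α : ℂ} (h : α ≠ n) (h2 : α ≠ 2) :
    (Hfun n α)⁻¹ * ((α - n) * (α - 2)) = -(Hfun n (α - 2))⁻¹ := by
  have hα : (α - 2) / 2 ≠ 0 := div_ne_zero (sub_ne_zero.2 h2) two_ne_zero
  have hnα : ((n : ℂ) - α) / 2 ≠ 0 := div_ne_zero (sub_ne_zero.2 h.symm) two_ne_zero
  have e1 : Gamma (α / 2) = (α - 2) / 2 * Gamma ((α - 2) / 2) := by
    rw [← Gamma_add_one _ hα]
    congr 1
    ring
  have e2 : Gamma (((n : ℂ) - (α - 2)) / 2) = ((n : ℂ) - α) / 2 * Gamma (((n : ℂ) - α) / 2) := by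
    rw [← Gamma_add_one _ hnα]
    congr 1
    ring
  have e3 : (2 : ℂ) ^ α = 4 * 2 ^ (α - 2) := by
    rw [cpow_sub _ _ two_ne_zero, cpow_ofNat]
    norm_num
    ring
  have ha : α - 2 ≠ 0 := sub_ne_zero.2 h2
  rw [Hfun, Hfun, e1, e2, e3]
  generalize Gamma ((α - 2) / 2) = G
  generalize Gamma (((n : ℂ) - α) / 2) = D
  generalize (2 : ℂ) ^ (α - 2) = P
  generalize (Real.pi : ℂ) ^ ((n : ℂ) / 2) = Q
  simp only [div_eq_mul_inv, mul_inv, inv_inv]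
  linear_combination (-((n : ℂ) - α) * D / 2 * P⁻¹ * Q⁻¹ * G⁻¹) * mul_inv_cancel₀ ha

theorem stmt_18 (n : ℕ) (hn : 0 < n) (ε : ℝ) (hε : 0 < ε)
    (φ : EuclideanSpace ℝ (Fin n) → ℂ) (hφ : ContDiff ℝ 2 φ)
    (hdecay0 : φ =O[cocompact (EuclideanSpace ℝ (Fin n))] fun x => ‖x‖ ^ (-(2 : ℝ) - ε))
    (hdecay1 : (fun x => iteratedFDeriv ℝ 1 φ x)
      =O[cocompact (EuclideanSpace ℝ (Fin n))] fun x => ‖x‖ ^ (-(2 : ℝ) - ε))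
    (hdecay2 : (fun x => iteratedFDeriv ℝ 2 φ x)
      =O[cocompact (EuclideanSpace ℝ (Fin n))] fun x => ‖x‖ ^ (-(2 : ℝ) - ε)) :
    ∀ α : ℂ, 2 < α.re → α.re < 2 + ε →
      (∀ m : ℕ, α ≠ (n : ℂ) + 2 * m) → (∀ m : ℕ, α - 2 ≠ (n : ℂ) + 2 * m) →
      ∀ x : EuclideanSpace ℝ (Fin n),
        Integrable (fun y => lap n φ y * (‖x - y‖ : ℂ) ^ (α - n)) ∧
        Integrable (fun y => φ y * (‖x - y‖ : ℂ) ^ (α - 2 - n)) ∧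
        riesz n (lap n φ) α x = -riesz n φ (α - 2) x := by
  intro α hα hαε hαn _ x
  set b : ℝ := -2 - ε with hb
  have : Nonempty (Fin n) := ⟨⟨0, hn⟩⟩
  have : Nontrivial (EuclideanSpace ℝ (Fin n)) := inferInstance
  have hfr : Module.finrank ℝ (EuclideanSpace ℝ (Fin n)) = n := by simp
  have hψ : ContDiff ℝ 2 fun y => φ (x + y) := hφ.comp (contDiff_const.add contDiff_id)
  have h0 := hdecay0.comp_const_add_rpow x
  have h1 (i : Fin n) : (fun y => fderiv ℝ (fun z => φ (x + z)) y (EuclideanSpace.single i 1))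
      =O[cocompact _] fun y => ‖y‖ ^ b := by
    simpa only [fderiv_comp_add_left] using (isBigO_partial hdecay1 i).comp_const_add_rpow x
  have h2 (i : Fin n) : (fun w => fderiv ℝ (fun y => fderiv ℝ (fun z => φ (x + z)) y
      (EuclideanSpace.single i 1)) w (EuclideanSpace.single i 1))
      =O[cocompact _] fun y => ‖y‖ ^ b := by
    have := (isBigO_partial_partial hφ hdecay2 i).comp_const_add_rpow x
    simp only [fderiv_comp_add_left]
    simpa only [fderiv_comp_add_left (f := fun z => fderiv ℝ φ z (EuclideanSpace.single i 1))]
      using this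
  have hlap : lap n (fun z => φ (x + z)) =O[cocompact _] fun y => ‖y‖ ^ b :=
    isBigO_lap h2
  have translate (g : EuclideanSpace ℝ (Fin n) → ℂ) (β : ℂ) :
      (fun y => g (x + y) * (‖x - (x + y)‖ : ℂ) ^ β) = fun y => g (x + y) * (‖y‖ : ℂ) ^ β := by
    simp
  refine ⟨?_, ?_, ?_⟩
  · rw [← (measurePreserving_add_left volume x).integrable_comp_emb (measurableEmbedding_addLeft x),
      Function.comp_def, translate]
    simp only [← lap_comp_const_add]
    refine integrable_mul_norm_cpow (continuous_lap hψ) hlap ?_ ?_ <;>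
      simp [hb] <;> linarith
  · rw [← (measurePreserving_add_left volume x).integrable_comp_emb (measurableEmbedding_addLeft x),
      Function.comp_def, translate]
    refine integrable_mul_norm_cpow hψ.continuous h0 ?_ ?_ <;>
      simp [hb] <;> linarith
  · have key := integral_lap_mul_norm_cpow hn hψ h0 h1 h2 α hα (by rw [hb]; linarith)
    simp only [riesz]
    rw [← integral_add_left_eq_self _ x, ← integral_add_left_eq_self (fun y => φ y * _) x,
      translate, translate]
    simp only [lap_comp_const_add] at key
    rw [key, ← mul_assoc, Hfun_inv_mul (by simpa using hαn 0) (by rintro rfl; simp at hα), neg_mul]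
end
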